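/- arXiv:2510.19308 — 4 statements merged into one kernel-verified Lean document; each statement's English description precedes it below -/
import Mathlib

section
/- For every homogeneous element G ∈ S of degree 6 and every D ∈ S with 3D = φ((f+3G)²) − (f+3G)⁶, the element ρ(f²·D) lies in m^[9] = (x⁹, y⁹, z⁹, w⁹) if and only if the coefficients g_{ijkl} of the monomials x^i y^j z^k w^l in ρ(G) ∈ k[x,y,z,w] satisfy g₂₀₂₀³ = g₁₁₂₀³ = g₀₂₂₀³ = 1 and g₂₂₁₀³ = −1. -/
open MvPolynomial

section TruncatedRing

variable {R : Type*} [CommRing R] {x y z w : R}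

theorem pow_five_of_cubes_eq_zero (h3 : (3 : R) = 0) {A B C : R} (hA : A ^ 5 = 0) (hB : B ^ 3 = 0)
    (hC : C ^ 3 = 0) : (A + B + C) ^ 5 = A ^ 3 * (B + C) ^ 2 + 2 * A ^ 4 * (B + C) := by
  have h : (A + B + C) ^ 3 = A ^ 3 := by
    linear_combination hB + hC +
      (A ^ 2 * (B + C) + A * (B + C) ^ 2 + B ^ 2 * C + B * C ^ 2) * h3
  linear_combination (A + B + C) ^ 2 * h + hA

theorem branch_cube_eq_zero (h3 : (3 : R) = 0) (hx : x ^ 9 = 0) (hy : y ^ 9 = 0) :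
    (-(x ^ 2 * y ^ 2 * (x + y) ^ 2)) ^ 3 = 0 := by
  have h : (x + y) ^ 3 = x ^ 3 + y ^ 3 := by
    linear_combination (x ^ 2 * y + x * y ^ 2) * h3
  have h6 : (x + y) ^ 6 = (x ^ 3 + y ^ 3) ^ 2 := by
    rw [← h]; ring
  linear_combination -(x ^ 6 * y ^ 6) * h6 -
    (x ^ 3 * y ^ 6 + 2 * y ^ 9) * hx - x ^ 6 * y ^ 3 * hy

theorem quartic_pow_five (h3 : (3 : R) = 0) (hx : x ^ 9 = 0) (hy : y ^ 9 = 0) (hz : z ^ 9 = 0)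
    (hw : w ^ 9 = 0) :
    (w ^ 2 + z ^ 3 - x ^ 2 * y ^ 2 * (x + y) ^ 2) ^ 5 =
      w ^ 6 * (z ^ 3 - x ^ 2 * y ^ 2 * (x + y) ^ 2) ^ 2 +
        2 * w ^ 8 * (z ^ 3 - x ^ 2 * y ^ 2 * (x + y) ^ 2) := by
  have h := pow_five_of_cubes_eq_zero h3 (A := w ^ 2) (B := z ^ 3)
    (by linear_combination w * hw) (by linear_combination hz) (branch_cube_eq_zero h3 hx hy)
  linear_combination h

/-- The reduction modulo `3` of the Frobenius defect `(φ(f) - f³) / 3`. -/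
def frobeniusDefect (x y z w : R) : R :=
  let q := x ^ 2 * y ^ 2 * (x + y) ^ 2
  let u := x * y * (x + y)
  x ^ 6 * y ^ 6 * (2 * (x ^ 3 + y ^ 3) * u + 3 * u ^ 2) -
    (w ^ 4 * z ^ 3 + w ^ 2 * z ^ 6 - w ^ 4 * q + w ^ 2 * q ^ 2 - z ^ 6 * q + z ^ 3 * q ^ 2 -
      2 * w ^ 2 * z ^ 3 * q)

theorem map_frobeniusDefect {T : Type*} [CommRing T] (ψ : R →+* T) (x y z w : R) :
    ψ (frobeniusDefect x y z w) = frobeniusDefect (ψ x) (ψ y) (ψ z) (ψ w) := by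
  simp only [frobeniusDefect, map_add, map_sub, map_mul, map_pow, map_ofNat]

theorem three_mul_frobeniusDefect (x y z w : R) :
    3 * frobeniusDefect x y z w =
      (w ^ 3) ^ 2 + (z ^ 3) ^ 3 - (x ^ 3) ^ 2 * (y ^ 3) ^ 2 * (x ^ 3 + y ^ 3) ^ 2 -
        (w ^ 2 + z ^ 3 - x ^ 2 * y ^ 2 * (x + y) ^ 2) ^ 3 := by
  unfold frobeniusDefect
  ring

theorem quartic_pow_five_mul_frobeniusDefect (h3 : (3 : R) = 0) (hx : x ^ 9 = 0) (hy : y ^ 9 = 0)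
    (hz : z ^ 9 = 0) (hw : w ^ 9 = 0) :
    (w ^ 2 + z ^ 3 - x ^ 2 * y ^ 2 * (x + y) ^ 2) ^ 5 * frobeniusDefect x y z w =
      -(w ^ 8 * z ^ 6 * (x ^ 2 * y ^ 2 * (x + y) ^ 2) ^ 2) := by
  have hC := branch_cube_eq_zero h3 hx hy
  have hδ : x ^ 6 * y ^ 6 * (2 * (x ^ 3 + y ^ 3) * (x * y * (x + y)) +
      3 * (x * y * (x + y)) ^ 2) = 0 := by
    linear_combination x ^ 6 * y ^ 6 * (x * y * (x + y)) ^ 2 * h3 +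
      2 * (x ^ 2 * y ^ 7 + x * y ^ 8) * hx + 2 * (x ^ 8 * y + x ^ 7 * y ^ 2) * hy
  rw [quartic_pow_five h3 hx hy hz hw, frobeniusDefect]
  generalize x ^ 2 * y ^ 2 * (x + y) ^ 2 = q at *
  have hq : q ^ 3 = 0 := by linear_combination -hC
  grind

/-- Modulo ninth powers, `f⁵ (δ(f) + g³)` is concentrated in the `z⁶w⁸`-part. -/
theorem quartic_pow_five_mul (h3 : (3 : R) = 0) (hx : x ^ 9 = 0) (hy : y ^ 9 = 0)
    (hz : z ^ 9 = 0) (hw : w ^ 9 = 0) (a b c d : R) :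
    (w ^ 2 + z ^ 3 - x ^ 2 * y ^ 2 * (x + y) ^ 2) ^ 5 *
        (frobeniusDefect x y z w + (a * x ^ 6 * z ^ 6 + b * x ^ 3 * y ^ 3 * z ^ 6 +
          c * y ^ 6 * z ^ 6 + d * x ^ 6 * y ^ 6 * z ^ 3)) =
      (a - 1) * x ^ 8 * y ^ 4 * z ^ 6 * w ^ 8 +
        (b - 1) * (x ^ 7 * y ^ 5 * z ^ 6 * w ^ 8 + x ^ 5 * y ^ 7 * z ^ 6 * w ^ 8) +
        (c - 1) * x ^ 4 * y ^ 8 * z ^ 6 * w ^ 8 +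
        2 * (b + d) * x ^ 6 * y ^ 6 * z ^ 6 * w ^ 8 := by
  rw [mul_add, quartic_pow_five_mul_frobeniusDefect h3 hx hy hz hw,
    quartic_pow_five h3 hx hy hz hw]
  grind

theorem quartic_pow_five_mul_w_cube (h3 : (3 : R) = 0) (hx : x ^ 9 = 0) (hy : y ^ 9 = 0)
    (hz : z ^ 9 = 0) (hw : w ^ 9 = 0) :
    (w ^ 2 + z ^ 3 - x ^ 2 * y ^ 2 * (x + y) ^ 2) ^ 5 * w ^ 3 = 0 := by
  rw [quartic_pow_five h3 hx hy hz hw]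
  generalize x ^ 2 * y ^ 2 * (x + y) ^ 2 = q
  linear_combination ((z ^ 3 - q) ^ 2 + 2 * w ^ 2 * (z ^ 3 - q)) * hw

end TruncatedRing

section NinthPowers

variable {k : Type*} [Field k]

theorem coeff_eq_zero_of_mem_span_ninth_powers {p : MvPolynomial (Fin 4) k}
    (hp : p ∈ Ideal.span ({X 0 ^ 9, X 1 ^ 9, X 2 ^ 9, X 3 ^ 9} : Set (MvPolynomial (Fin 4) k)))
    {e : Fin 4 →₀ ℕ} (he : ∀ i, e i < 9) : coeff e p = 0 := by
  have hset : ({X 0 ^ 9, X 1 ^ 9, X 2 ^ 9, X 3 ^ 9} : Set (MvPolynomial (Fin 4) k)) =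
      (fun s => monomial s (1 : k)) '' Set.range fun i : Fin 4 => Finsupp.single i 9 := by
    ext q
    simp [X_pow_eq_monomial, Fin.exists_fin_succ, eq_comm]
  rw [hset, mem_ideal_span_monomial_image] at hp
  by_contra hne
  obtain ⟨_, ⟨i, rfl⟩, hi⟩ := hp e (mem_support_iff.mpr hne)
  have := hi i
  have := he i
  simp at *
  omega

theorem top_combination_mem_iff (a b c d : k) :
    C a * X 0 ^ 8 * X 1 ^ 4 * X 2 ^ 6 * X 3 ^ 8 +
        C b * (X 0 ^ 7 * X 1 ^ 5 * X 2 ^ 6 * X 3 ^ 8 + X 0 ^ 5 * X 1 ^ 7 * X 2 ^ 6 * X 3 ^ 8) +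
        C c * X 0 ^ 4 * X 1 ^ 8 * X 2 ^ 6 * X 3 ^ 8 +
        C d * X 0 ^ 6 * X 1 ^ 6 * X 2 ^ 6 * X 3 ^ 8 ∈
      Ideal.span ({X 0 ^ 9, X 1 ^ 9, X 2 ^ 9, X 3 ^ 9} : Set (MvPolynomial (Fin 4) k)) ↔
    a = 0 ∧ b = 0 ∧ c = 0 ∧ d = 0 := by
  constructor
  · intro h
    have key (i j : ℕ) (hi : i < 9) (hj : j < 9) :=
      coeff_eq_zero_of_mem_span_ninth_powers h
        (e := Finsupp.single 0 i + Finsupp.single 1 j + Finsupp.single 2 6 + Finsupp.single 3 8)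
        (by simp [Fin.forall_fin_succ, Finsupp.single_apply, hi, hj])
    simp only [X_pow_eq_monomial, mul_add, C_mul_monomial, monomial_mul, coeff_add,
      coeff_monomial, mul_one, Finsupp.ext_iff, Fin.forall_fin_succ, Finsupp.add_apply,
      Finsupp.single_apply] at key
    refine ⟨?_, ?_, ?_, ?_⟩
    · simpa using key 8 4
    · simpa using key 7 5
    · simpa using key 4 8
    · simpa using key 6 6
  · rintro ⟨rfl, rfl, rfl, rfl⟩
    simp

/-- A form of degree six is determined by four coefficients modulo `(x³, y³, z³, w)`. -/
theorem sextic_sub_mem_span {g : MvPolynomial (Fin 4) k}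
    (hg : IsWeightedHomogeneous (![1, 1, 2, 3] : Fin 4 → ℕ) g 6) :
    g - (monomial (Finsupp.single 0 2 + Finsupp.single 2 2)
          (coeff (Finsupp.single 0 2 + Finsupp.single 2 2) g) +
        monomial (Finsupp.single 0 1 + Finsupp.single 1 1 + Finsupp.single 2 2)
          (coeff (Finsupp.single 0 1 + Finsupp.single 1 1 + Finsupp.single 2 2) g) +
        monomial (Finsupp.single 1 2 + Finsupp.single 2 2)
          (coeff (Finsupp.single 1 2 + Finsupp.single 2 2) g) +
        monomial (Finsupp.single 0 2 + Finsupp.single 1 2 + Finsupp.single 2 1)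
          (coeff (Finsupp.single 0 2 + Finsupp.single 1 2 + Finsupp.single 2 1) g)) ∈
      Ideal.span ({X 0 ^ 3, X 1 ^ 3, X 2 ^ 3, X 3} : Set (MvPolynomial (Fin 4) k)) := by
  have hset : ({X 0 ^ 3, X 1 ^ 3, X 2 ^ 3, X 3} : Set (MvPolynomial (Fin 4) k)) =
      (fun s => monomial s (1 : k)) '' Set.range fun i : Fin 4 =>
        Finsupp.single i ((![3, 3, 3, 1] : Fin 4 → ℕ) i) := by
    ext q
    simp only [X_pow_eq_monomial]
    simp [Fin.exists_fin_succ, eq_comm, X]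
  rw [hset, mem_ideal_span_monomial_image]
  intro m hm
  by_contra! hlt
  simp only [Set.forall_mem_range, Finsupp.single_le_iff, not_le] at hlt
  have h0 : m 0 < 3 := hlt 0
  have h1 : m 1 < 3 := hlt 1
  have h2 : m 2 < 3 := hlt 2
  have h3 : m 3 = 0 := Nat.lt_one_iff.mp (hlt 3)
  have hext (u v : Fin 4 →₀ ℕ) : u = v ↔ u 0 = v 0 ∧ u 1 = v 1 ∧ u 2 = v 2 ∧ u 3 = v 3 := by
    simp [Finsupp.ext_iff, Fin.forall_fin_succ]
  refine mem_support_iff.mp hm ?_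
  simp only [coeff_sub, coeff_add, coeff_monomial]
  by_cases hcases : m = Finsupp.single 0 2 + Finsupp.single 2 2 ∨
      m = Finsupp.single 0 1 + Finsupp.single 1 1 + Finsupp.single 2 2 ∨
      m = Finsupp.single 1 2 + Finsupp.single 2 2 ∨
      m = Finsupp.single 0 2 + Finsupp.single 1 2 + Finsupp.single 2 1
  · rcases hcases with rfl | rfl | rfl | rfl <;> simp [hext]
  · have hzero : coeff m g = 0 := by
      by_contra hne
      have hw := hg hne
      simp only [Finsupp.weight_apply, Finsupp.sum_fintype, Fin.sum_univ_four, zero_smul,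
        implies_true] at hw
      simp [h3] at hw
      apply hcases
      simp [hext, h3]
      omega
    simp only [not_or, ← ne_eq] at hcases
    obtain ⟨n1, n2, n3, n4⟩ := hcases
    simp [hzero, n1.symm, n2.symm, n3.symm, n4.symm]

end NinthPowers

section Reduction

variable {k : Type*} [Field k] [CharP k 3]

theorem map_frobenius_lift_eq_pow_three
    {φ : MvPolynomial (Fin 4) (WittVector 3 k) →+* MvPolynomial (Fin 4) (WittVector 3 k)}
    (hφC : ∀ α : WittVector 3 k, φ (C α) = C (WittVector.frobenius α))
    (hφX : ∀ i : Fin 4, φ (X i) = X i ^ 3)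
    {r : WittVector 3 k →+* k} (hr : ∀ α : WittVector 3 k, r α = α.coeff 0)
    (g : MvPolynomial (Fin 4) (WittVector 3 k)) :
    map r (φ g) = map r g ^ 3 := by
  have h : (map r).comp φ = (frobenius (MvPolynomial (Fin 4) k) 3).comp (map r) := by
    apply MvPolynomial.ringHom_ext
    · intro α
      simp [hφC, hr, WittVector.coeff_frobenius_charP, frobenius_def]
    · intro i
      simp [hφX, frobenius_def]
  exact DFunLike.congr_fun h g

theorem three_mul_injective {p q : MvPolynomial (Fin 4) (WittVector 3 k)} (h : 3 * p = 3 * q) :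
    p = q := by
  refine mul_left_cancel₀ (fun h3 => WittVector.p_nonzero 3 k ?_) h
  apply C_injective (Fin 4) (WittVector 3 k)
  rw [map_natCast, map_zero]
  exact_mod_cast h3

/-- Expanding `δ(F²)` for `F = f + 3G` and reducing modulo `3`. -/
theorem map_delta_sq
    {φ : MvPolynomial (Fin 4) (WittVector 3 k) →+* MvPolynomial (Fin 4) (WittVector 3 k)}
    (hφC : ∀ α : WittVector 3 k, φ (C α) = C (WittVector.frobenius α))
    (hφX : ∀ i : Fin 4, φ (X i) = X i ^ 3)
    {r : WittVector 3 k →+* k} (hr : ∀ α : WittVector 3 k, r α = α.coeff 0)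
    {f G D E : MvPolynomial (Fin 4) (WittVector 3 k)} (hE : 3 * E = φ f - f ^ 3)
    (hD : 3 * D = φ ((f + 3 * G) ^ 2) - (f + 3 * G) ^ 6) :
    map r D = 2 * map r f ^ 3 * (map r E + map r G ^ 3) := by
  have hF : φ (f + 3 * G) = (f + 3 * G) ^ 3 +
      3 * (E + φ G - 3 * f ^ 2 * G - 9 * f * G ^ 2 - 9 * G ^ 3) := by
    simp only [map_add, map_mul, map_ofNat]
    linear_combination -hE
  have hD' : D = 2 * (f + 3 * G) ^ 3 * (E + φ G - 3 * f ^ 2 * G - 9 * f * G ^ 2 - 9 * G ^ 3) +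
      3 * (E + φ G - 3 * f ^ 2 * G - 9 * f * G ^ 2 - 9 * G ^ 3) ^ 2 := by
    apply three_mul_injective
    rw [hD, map_pow, hF]
    ring
  have h3 : (3 : MvPolynomial (Fin 4) k) = 0 := by
    exact_mod_cast CharP.cast_eq_zero (MvPolynomial (Fin 4) k) 3
  have h9 : (9 : MvPolynomial (Fin 4) k) = 0 := by linear_combination 3 * h3
  rw [hD']
  simp [h3, h9, map_frobenius_lift_eq_pow_three hφC hφX hr]

theorem quartic_pow_five_mul_mem_iff {g : MvPolynomial (Fin 4) k}
    (hg : IsWeightedHomogeneous (![1, 1, 2, 3] : Fin 4 → ℕ) g 6) :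
    (X 3 ^ 2 + X 2 ^ 3 - X 0 ^ 2 * X 1 ^ 2 * (X 0 + X 1) ^ 2) ^ 5 *
        (frobeniusDefect (X 0) (X 1) (X 2) (X 3) + g ^ 3) ∈
      Ideal.span ({X 0 ^ 9, X 1 ^ 9, X 2 ^ 9, X 3 ^ 9} : Set (MvPolynomial (Fin 4) k)) ↔
    coeff (Finsupp.single 0 2 + Finsupp.single 2 2) g ^ 3 = 1 ∧
      coeff (Finsupp.single 0 1 + Finsupp.single 1 1 + Finsupp.single 2 2) g ^ 3 = 1 ∧
      coeff (Finsupp.single 1 2 + Finsupp.single 2 2) g ^ 3 = 1 ∧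
      coeff (Finsupp.single 0 2 + Finsupp.single 1 2 + Finsupp.single 2 1) g ^ 3 = -1 := by
  have hrem := sextic_sub_mem_span hg
  set a := coeff (Finsupp.single 0 2 + Finsupp.single 2 2) g
  set b := coeff (Finsupp.single 0 1 + Finsupp.single 1 1 + Finsupp.single 2 2) g
  set c := coeff (Finsupp.single 1 2 + Finsupp.single 2 2) g
  set d := coeff (Finsupp.single 0 2 + Finsupp.single 1 2 + Finsupp.single 2 1) g
  set I := Ideal.span ({X 0 ^ 9, X 1 ^ 9, X 2 ^ 9, X 3 ^ 9} : Set (MvPolynomial (Fin 4) k))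
    with hI
  have hX (i : Fin 4) : Ideal.Quotient.mk I (X i) ^ 9 = 0 := by
    rw [← map_pow, Ideal.Quotient.eq_zero_iff_mem]
    apply Ideal.subset_span
    fin_cases i <;> simp
  have h3' : (3 : k) = 0 := by exact_mod_cast CharP.cast_eq_zero k 3
  have h3 : (3 : MvPolynomial (Fin 4) k) = 0 := by
    exact_mod_cast CharP.cast_eq_zero (MvPolynomial (Fin 4) k) 3
  have hQ3 : (3 : MvPolynomial (Fin 4) k ⧸ I) = 0 := by
    rw [← map_ofNat (Ideal.Quotient.mk I) 3, h3, map_zero]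
  have hcube (u v : MvPolynomial (Fin 4) k) : (u + v) ^ 3 = u ^ 3 + v ^ 3 := by
    linear_combination (u ^ 2 * v + u * v ^ 2) * h3
  have hkill {p : MvPolynomial (Fin 4) k}
      (hp : p ∈ Ideal.span ({X 0 ^ 3, X 1 ^ 3, X 2 ^ 3, X 3} : Set (MvPolynomial (Fin 4) k))) :
      (X 3 ^ 2 + X 2 ^ 3 - X 0 ^ 2 * X 1 ^ 2 * (X 0 + X 1) ^ 2) ^ 5 * p ^ 3 ∈ I := by
    induction hp using Submodule.span_induction with
    | mem p hp =>
      have hw := quartic_pow_five_mul_w_cube hQ3 (hX 0) (hX 1) (hX 2) (hX 3)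
      rw [← Ideal.Quotient.eq_zero_iff_mem]
      simp only [map_mul, map_pow, map_add, map_sub]
      rcases hp with rfl | rfl | rfl | rfl
      · rw [map_pow, ← pow_mul, hX, mul_zero]
      · rw [map_pow, ← pow_mul, hX, mul_zero]
      · rw [map_pow, ← pow_mul, hX, mul_zero]
      · exact hw
    | zero => simp
    | add u v _ _ hu hv =>
      rw [hcube, mul_add]
      exact I.add_mem hu hv
    | smul s u _ hu =>
      rw [smul_eq_mul, mul_pow, mul_left_comm]
      exact I.mul_mem_left _ hu
  set g₀ : MvPolynomial (Fin 4) k := monomial (Finsupp.single 0 2 + Finsupp.single 2 2) a +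
        monomial (Finsupp.single 0 1 + Finsupp.single 1 1 + Finsupp.single 2 2) b +
        monomial (Finsupp.single 1 2 + Finsupp.single 2 2) c +
        monomial (Finsupp.single 0 2 + Finsupp.single 1 2 + Finsupp.single 2 1) d with hg₀
  have hg₀3 : g₀ ^ 3 = C (a ^ 3) * X 0 ^ 6 * X 2 ^ 6 + C (b ^ 3) * X 0 ^ 3 * X 1 ^ 3 * X 2 ^ 6 +
      C (c ^ 3) * X 1 ^ 6 * X 2 ^ 6 + C (d ^ 3) * X 0 ^ 6 * X 1 ^ 6 * X 2 ^ 3 := by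
    rw [hg₀, hcube, hcube, hcube]
    simp only [X_pow_eq_monomial, C_mul_monomial, monomial_mul, monomial_pow]
    simp
  have hsplit : g ^ 3 = g₀ ^ 3 + (g - g₀) ^ 3 := by rw [← hcube, add_sub_cancel]
  rw [hsplit, ← add_assoc, mul_add, I.add_mem_iff_left (hkill hrem)]
  have hQ := quartic_pow_five_mul hQ3 (hX 0) (hX 1) (hX 2) (hX 3)
    (Ideal.Quotient.mk I (C (a ^ 3))) (Ideal.Quotient.mk I (C (b ^ 3)))
    (Ideal.Quotient.mk I (C (c ^ 3))) (Ideal.Quotient.mk I (C (d ^ 3)))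
  have hQ' := top_combination_mem_iff (a ^ 3 - 1) (b ^ 3 - 1) (c ^ 3 - 1) (2 * (b ^ 3 + d ^ 3))
  rw [← hI, ← Ideal.Quotient.eq_zero_iff_mem] at hQ'
  rw [← Ideal.Quotient.eq_zero_iff_mem, hg₀3]
  simp only [map_mul, map_add, map_sub, map_pow, map_one, map_ofNat, map_frobeniusDefect] at hQ hQ' ⊢
  rw [hQ, hQ']
  constructor
  · rintro ⟨ha, hb, hc, hd⟩
    refine ⟨sub_eq_zero.mp ha, sub_eq_zero.mp hb, sub_eq_zero.mp hc, ?_⟩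
    linear_combination -hd - hb + (b ^ 3 + d ^ 3) * h3'
  · rintro ⟨ha, hb, hc, hd⟩
    refine ⟨sub_eq_zero.mpr ha, sub_eq_zero.mpr hb, sub_eq_zero.mpr hc, ?_⟩
    linear_combination 2 * hb + 2 * hd

end Reduction

/-- 4A₂ del Pezzo, key computation.
`k` is an algebraically closed field of characteristic 3, `S = W(k)[x,y,z,w]` with
`deg x = deg y = 1`, `deg z = 2`, `deg w = 3`, `φ` acts on coefficients by the Witt vector
Frobenius and cubes the variables, `ρ` reduces coefficients via the 0-th Witt coordinate,
and `f = w² + z³ − x²y²(x+y)²`. For every homogeneous `G` of degree 6 and every `D` with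
`3D = φ((f+3G)²) − (f+3G)⁶`: `ρ(f²·D) ∈ (x⁹,y⁹,z⁹,w⁹)` if and only if the coefficients
`g_{ijkl}` of `x^i y^j z^k w^l` in `ρ(G)` satisfy
`g₂₀₂₀³ = g₁₁₂₀³ = g₀₂₂₀³ = 1` and `g₂₂₁₀³ = −1`. -/
theorem stmt14 (k : Type*) [Field k] [IsAlgClosed k] [CharP k 3]
    (φ : MvPolynomial (Fin 4) (WittVector 3 k) →+* MvPolynomial (Fin 4) (WittVector 3 k))
    (hφC : ∀ α : WittVector 3 k, φ (C α) = C (WittVector.frobenius α))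
    (hφX : ∀ i : Fin 4, φ (X i) = X i ^ 3)
    (r : WittVector 3 k →+* k)
    (hr : ∀ α : WittVector 3 k, r α = α.coeff 0)
    (f : MvPolynomial (Fin 4) (WittVector 3 k))
    (hf : f = X 3 ^ 2 + X 2 ^ 3 - X 0 ^ 2 * X 1 ^ 2 * (X 0 + X 1) ^ 2)
    (G : MvPolynomial (Fin 4) (WittVector 3 k))
    (hG : MvPolynomial.IsWeightedHomogeneous (![1, 1, 2, 3] : Fin 4 → ℕ) G 6)
    (D : MvPolynomial (Fin 4) (WittVector 3 k))
    (hD : 3 * D = φ ((f + 3 * G) ^ 2) - (f + 3 * G) ^ 6) :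
    MvPolynomial.map r (f ^ 2 * D)
        ∈ Ideal.span ({X 0 ^ 9, X 1 ^ 9, X 2 ^ 9, X 3 ^ 9} : Set (MvPolynomial (Fin 4) k)) ↔
      ((MvPolynomial.coeff (Finsupp.single 0 2 + Finsupp.single 2 2)
          (MvPolynomial.map r G)) ^ 3 = 1 ∧
       (MvPolynomial.coeff (Finsupp.single 0 1 + Finsupp.single 1 1 + Finsupp.single 2 2)
          (MvPolynomial.map r G)) ^ 3 = 1 ∧
       (MvPolynomial.coeff (Finsupp.single 1 2 + Finsupp.single 2 2)
          (MvPolynomial.map r G)) ^ 3 = 1 ∧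
       (MvPolynomial.coeff (Finsupp.single 0 2 + Finsupp.single 1 2 + Finsupp.single 2 1)
          (MvPolynomial.map r G)) ^ 3 = -1) := by
  have hE : 3 * frobeniusDefect (X 0) (X 1) (X 2) (X 3) = φ f - f ^ 3 := by
    rw [three_mul_frobeniusDefect, hf]
    simp only [map_add, map_sub, map_mul, map_pow, hφX]
  have hρE : map r (frobeniusDefect (X 0) (X 1) (X 2) (X (3 : Fin 4))) =
      frobeniusDefect (X 0) (X 1) (X 2) (X 3) := by
    simp only [map_frobeniusDefect, map_X]
  have hρf : map r f = X 3 ^ 2 + X 2 ^ 3 - X 0 ^ 2 * X 1 ^ 2 * (X 0 + X 1) ^ 2 := by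
    simp [hf]
  have hρG : IsWeightedHomogeneous (![1, 1, 2, 3] : Fin 4 → ℕ) (map r G) 6 := by
    intro m hm
    refine hG fun h => hm ?_
    rw [coeff_map, h, map_zero]
  have h3 : (3 : MvPolynomial (Fin 4) k) = 0 := by
    exact_mod_cast CharP.cast_eq_zero (MvPolynomial (Fin 4) k) 3
  have hneg : map r (f ^ 2 * D) =
      -((X 3 ^ 2 + X 2 ^ 3 - X 0 ^ 2 * X 1 ^ 2 * (X 0 + X 1) ^ 2) ^ 5 *
      (frobeniusDefect (X 0) (X 1) (X 2) (X 3) + map r G ^ 3)) := by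
    rw [map_mul, map_pow, map_delta_sq hφC hφX hr hE hD, hρE, hρf]
    linear_combination (X 3 ^ 2 + X 2 ^ 3 - X 0 ^ 2 * X 1 ^ 2 * (X 0 + X 1) ^ 2) ^ 5 *
      (frobeniusDefect (X 0) (X 1) (X 2) (X 3) + map r G ^ 3) * h3
  rw [hneg, neg_mem_iff]
  exact quartic_pow_five_mul_mem_iff hρG
end

section
/- The element ρ(f²) lies in m^[3] = (x³, y³, z³, w³), and for every D ∈ S with 3D = φ(f²) − f⁶, the element ρ(f²·D) does not lie in m^[9] = (x⁹, y⁹, z⁹, w⁹). (This is the computational content of the statement that W(k)[x,y,z,w]/(f) has quasi-F-splitting height exactly 2.) -/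
open MvPolynomial

/-- `(φ(f) - f³) / 3` for `f = w² + z³ - x²y²(x+y)²`, where `φ` cubes the variables. -/
def dpDelta {A : Type*} [CommRing A] (x y z w : A) : A :=
  x ^ 7 * y ^ 7 * (x + y) * (2 * (x ^ 3 + y ^ 3) + 3 * (x * y * (x + y)))
    - (w ^ 2) ^ 2 * z ^ 3 - w ^ 2 * (z ^ 3) ^ 2
    + (w ^ 2) ^ 2 * (x ^ 2 * y ^ 2 * (x + y) ^ 2) - w ^ 2 * (x ^ 2 * y ^ 2 * (x + y) ^ 2) ^ 2
    + (z ^ 3) ^ 2 * (x ^ 2 * y ^ 2 * (x + y) ^ 2) - z ^ 3 * (x ^ 2 * y ^ 2 * (x + y) ^ 2) ^ 2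
    + 2 * (z ^ 3 * w ^ 2 * (x ^ 2 * y ^ 2 * (x + y) ^ 2))

theorem three_mul_dpDelta {A : Type*} [CommRing A] (x y z w : A) :
    3 * dpDelta x y z w =
      ((w ^ 3) ^ 2 + (z ^ 3) ^ 3 - (x ^ 3) ^ 2 * (y ^ 3) ^ 2 * (x ^ 3 + y ^ 3) ^ 2)
        - (w ^ 2 + z ^ 3 - x ^ 2 * y ^ 2 * (x + y) ^ 2) ^ 3 := by
  unfold dpDelta
  ring

theorem map_dpDelta {A B : Type*} [CommRing A] [CommRing B] (g : A →+* B) (x y z w : A) :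
    g (dpDelta x y z w) = dpDelta (g x) (g y) (g z) (g w) := by
  simp only [dpDelta, map_add, map_sub, map_mul, map_pow, map_ofNat]

theorem mul_trinomial_pow_five {A : Type*} [CommRing A] {t u v s : A} (h3 : (3 : A) = 0)
    (hu : u ^ 3 = 0) (hv : v ^ 5 = 0) (hs : t * s ^ 3 = 0) :
    t * (2 * (v + u - s) ^ 5 * (- v ^ 2 * u - v * u ^ 2 + v ^ 2 * s - v * s ^ 2
      + u ^ 2 * s - u * s ^ 2 + 2 * (u * v * s))) = t * (u ^ 2 * v ^ 4 * s ^ 2) := by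
  grind

theorem socle_eq {A : Type*} [CommRing A] {x y z w : A} (h3 : (3 : A) = 0)
    (hy : y ^ 9 = 0) (hz : z ^ 9 = 0) (hw : w ^ 9 = 0) :
    y ^ 4 * z ^ 2 * (2 * (w ^ 2 + z ^ 3 - x ^ 2 * y ^ 2 * (x + y) ^ 2) ^ 5 * dpDelta x y z w) =
      x ^ 8 * y ^ 8 * z ^ 8 * w ^ 8 := by
  have key := mul_trinomial_pow_five (t := y ^ 4) (u := z ^ 3) (v := w ^ 2)
    (s := x ^ 2 * y ^ 2 * (x + y) ^ 2) h3 (by linear_combination hz)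
    (by linear_combination w * hw) (by linear_combination (x ^ 6 * y * (x + y) ^ 6) * hy)
  unfold dpDelta
  linear_combination z ^ 2 * key
    + (2 * z ^ 2 * (w ^ 2 + z ^ 3 - x ^ 2 * y ^ 2 * (x + y) ^ 2) ^ 5
        * x ^ 7 * y ^ 2 * (x + y) * (2 * (x ^ 3 + y ^ 3) + 3 * (x * y * (x + y)))) * hy
    + (z ^ 8 * w ^ 8 * x ^ 4 * (4 * x ^ 3 + 6 * x ^ 2 * y + 4 * x * y ^ 2 + y ^ 3)) * hy

theorem X_pow_eight_notMem (k : Type*) [Field k] :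
    (X 0 ^ 8 * X 1 ^ 8 * X 2 ^ 8 * X 3 ^ 8 : MvPolynomial (Fin 4) k) ∉
      Ideal.span ({X 0 ^ 9, X 1 ^ 9, X 2 ^ 9, X 3 ^ 9} : Set (MvPolynomial (Fin 4) k)) := by
  classical
  have hset : ({X 0 ^ 9, X 1 ^ 9, X 2 ^ 9, X 3 ^ 9} : Set (MvPolynomial (Fin 4) k)) =
      (fun s => monomial s (1 : k)) '' Set.range fun i : Fin 4 => Finsupp.single i 9 := by
    ext p
    simp [X_pow_eq_monomial, Fin.exists_fin_succ, eq_comm]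
  have hmon : (X 0 ^ 8 * X 1 ^ 8 * X 2 ^ 8 * X 3 ^ 8 : MvPolynomial (Fin 4) k) =
      monomial (Finsupp.equivFunOnFinite.symm fun _ => 8) 1 := by
    rw [monomial_eq, Finsupp.prod_fintype _ _ (by simp)]
    simp [Fin.prod_univ_four]
  rw [hset, hmon, mem_ideal_span_monomial_image]
  intro h
  obtain ⟨_, ⟨i, rfl⟩, hi⟩ := h (Finsupp.equivFunOnFinite.symm fun _ => 8) (by simp)
  simpa using hi i

/-- 4A₂ del Pezzo: `W(k)[x,y,z,w]/(f)` has quasi-F-splitting height 2.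
With notation as in the 4A₂ setting (characteristic 3, `f = w² + z³ − x²y²(x+y)²`):
`ρ(f²) ∈ (x³, y³, z³, w³)`, and for every `D ∈ S` with `3D = φ(f²) − f⁶`,
`ρ(f²·D) ∉ (x⁹, y⁹, z⁹, w⁹)`. -/
theorem stmt15 (k : Type*) [Field k] [IsAlgClosed k] [CharP k 3]
    (φ : MvPolynomial (Fin 4) (WittVector 3 k) →+* MvPolynomial (Fin 4) (WittVector 3 k))
    (hφC : ∀ α : WittVector 3 k, φ (C α) = C (WittVector.frobenius α))
    (hφX : ∀ i : Fin 4, φ (X i) = X i ^ 3)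
    (r : WittVector 3 k →+* k)
    (hr : ∀ α : WittVector 3 k, r α = α.coeff 0)
    (f : MvPolynomial (Fin 4) (WittVector 3 k))
    (hf : f = X 3 ^ 2 + X 2 ^ 3 - X 0 ^ 2 * X 1 ^ 2 * (X 0 + X 1) ^ 2)
    :
    MvPolynomial.map r (f ^ 2)
        ∈ Ideal.span ({X 0 ^ 3, X 1 ^ 3, X 2 ^ 3, X 3 ^ 3} : Set (MvPolynomial (Fin 4) k)) ∧
    ∀ D : MvPolynomial (Fin 4) (WittVector 3 k), 3 * D = φ (f ^ 2) - f ^ 6 →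
      MvPolynomial.map r (f ^ 2 * D)
        ∉ Ideal.span ({X 0 ^ 9, X 1 ^ 9, X 2 ^ 9, X 3 ^ 9} : Set (MvPolynomial (Fin 4) k)) := by
  constructor
  · subst hf
    have hmem : ∀ i : Fin 4, (X i ^ 3 : MvPolynomial (Fin 4) k) ∈ Ideal.span
        ({X 0 ^ 3, X 1 ^ 3, X 2 ^ 3, X 3 ^ 3} : Set (MvPolynomial (Fin 4) k)) := fun i =>
      Ideal.subset_span (by fin_cases i <;> simp)
    simp only [← Ideal.Quotient.eq_zero_iff_mem, map_pow] at hmem ⊢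
    simp only [map_add, map_sub, map_mul, map_pow, map_X]
    have hx := hmem 0
    have hy := hmem 1
    have hz := hmem 2
    have hw := hmem 3
    grind
  · intro D hD hmem
    have hD' : D = dpDelta (X 0) (X 1) (X 2) (X 3) *
        (2 * f ^ 3 + 3 * dpDelta (X 0) (X 1) (X 2) (X 3)) := by
      have h3 : (3 : MvPolynomial (Fin 4) (WittVector 3 k)) ≠ 0 := by
        rw [← map_ofNat (C : WittVector 3 k →+* _) 3, Ne, C_eq_zero]
        exact_mod_cast WittVector.p_nonzero 3 k
      apply mul_left_cancel₀ h3
      have hφf : φ f = f ^ 3 + 3 * dpDelta (X 0) (X 1) (X 2) (X 3) := by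
        rw [three_mul_dpDelta, hf]
        simp only [map_add, map_sub, map_mul, map_pow, hφX]
        ring
      rw [hD, map_pow, hφf]
      ring
    have h3 : (3 : MvPolynomial (Fin 4) k) = 0 := by
      exact_mod_cast CharP.cast_eq_zero (MvPolynomial (Fin 4) k) 3
    set I := Ideal.span ({X 0 ^ 9, X 1 ^ 9, X 2 ^ 9, X 3 ^ 9} : Set (MvPolynomial (Fin 4) k))
      with hI
    have hX : ∀ i : Fin 4, Ideal.Quotient.mk I (X i) ^ 9 = 0 := fun i => by
      rw [← map_pow, Ideal.Quotient.eq_zero_iff_mem]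
      exact Ideal.subset_span (by fin_cases i <;> simp)
    have h3' : (3 : MvPolynomial (Fin 4) k ⧸ I) = 0 := by
      rw [← map_ofNat (Ideal.Quotient.mk I) 3, h3, map_zero]
    apply X_pow_eight_notMem k
    rw [← hI, ← Ideal.Quotient.eq_zero_iff_mem]
    rw [← Ideal.Quotient.eq_zero_iff_mem, hD', hf] at hmem
    simp only [map_add, map_sub, map_mul, map_pow, map_dpDelta, map_X, map_ofNat] at hmem ⊢
    rw [← socle_eq h3' (hX 1) (hX 2) (hX 3)]
    rw [h3'] at hmem
    linear_combination (Ideal.Quotient.mk I (X 1) ^ 4 * Ideal.Quotient.mk I (X 2) ^ 2) * hmem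
end

section
/- Let G = xyz² + x²z² + y²z² − x²y²z ∈ S. For every D ∈ S with 3D = φ((f+3G)²) − (f+3G)⁶, one has ρ(f²·D) ∈ m^[9] = (x⁹, y⁹, z⁹, w⁹) and ρ(f²·D⁴) ∉ m^[27] = (x²⁷, y²⁷, z²⁷, w²⁷). (This is the computational content of the statement that W(k)[x,y,z,w]/(f + 3(xyz² + x²z² + y²z² − x²y²z)) has quasi-F-splitting height exactly 3.) -/
open MvPolynomial

section CharThree

variable {R : Type*} [CommRing R]

theorem add_cube_of_three_eq_zero (h3 : (3 : R) = 0) (a b : R) :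
    (a + b) ^ 3 = a ^ 3 + b ^ 3 := by
  linear_combination (a ^ 2 * b + a * b ^ 2) * h3

theorem sub_cube_of_three_eq_zero (h3 : (3 : R) = 0) (a b : R) :
    (a - b) ^ 3 = a ^ 3 - b ^ 3 := by
  linear_combination (-a ^ 2 * b + a * b ^ 2) * h3

/-- The reduction modulo `3` of `(φ(f + 3G) - (f + 3G)³) / 3`, where `a = w²`, `b = z³`,
`c = x²y²(x+y)²`, and `e`, `g`, `h` are the forms in `x`, `y` coming from `c` and `G`. -/
def deltaForm (a b c e g h : R) : R :=
  -((a + b) * (a - c) * (b - c)) - e + b ^ 2 * g - b * h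

theorem map_deltaForm {S : Type*} [CommRing S] (q : R →+* S) (a b c e g h : R) :
    q (deltaForm a b c e g h) = deltaForm (q a) (q b) (q c) (q e) (q g) (q h) := by
  simp [deltaForm]

theorem deltaForm_cube (h3 : (3 : R) = 0) (a b c e g h : R) :
    deltaForm a b c e g h ^ 3 =
      deltaForm (a ^ 3) (b ^ 3) (c ^ 3) (e ^ 3) (g ^ 3) (h ^ 3) := by
  have hneg (t : R) : (-t) ^ 3 = -t ^ 3 := by ring
  simp only [deltaForm, add_cube_of_three_eq_zero h3, sub_cube_of_three_eq_zero h3, mul_pow, hneg]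
  ring

/-- Extraction of the only surviving term, that of `a * b ^ 2`, in `(a + b - c)² * deltaForm`. -/
theorem mul_sq_mul_deltaForm (h3 : (3 : R) = 0) {m a b c e g h : R}
    (ha : m * a ^ 2 = 0) (hb : m * b ^ 3 = 0) (hc : m * c ^ 3 = 0) (hcg : m * (c ^ 2 * g) = 0)
    (hch : m * (c * h) = 0) (he : m * e = 0) :
    m * ((a + b - c) ^ 2 * deltaForm a b c e g h) =
      m * (a * b ^ 2) * (c * g + h - c ^ 2) := by
  unfold deltaForm
  linear_combination (-a ^ 2 * b + a ^ 2 * c - 3 * a * b ^ 2 + 6 * a * b * c - 3 * a * c ^ 2 - 3 *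
    b ^ 3 + 10 * b ^ 2 * c + b ^ 2 * g - 10 * b * c ^ 2 - b * h + 3 * c ^ 3 - e) * ha + (-a * b +
    6 * a * c + 2 * a * g + b * c + b * g - 3 * c ^ 2 - 2 * c * g - h) * hb + (6 * a * b - a * c +
    3 * b ^ 2 - b * c) * hc + (b ^ 2) * hcg + (2 * a * b + 2 * b ^ 2 - b * c) * hch + (-2 * a * b
    + 2 * a * c - b ^ 2 + 2 * b * c - c ^ 2) * he + (-3 * m * a * b ^ 2 * c ^ 2 - m * a * b ^ 2 *
    c * g - m * a * b ^ 2 * h) * h3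

/-- Extraction of the only surviving term, that of `a * b ^ 2`, in `(a + b - c) * deltaForm`. -/
theorem mul_mul_deltaForm (h3 : (3 : R) = 0) {m a b c e g h : R}
    (ha : m * a ^ 2 = 0) (hb : m * b ^ 3 = 0) (hc : m * c ^ 2 = 0) (hcg : m * (c * g) = 0)
    (hh : m * h = 0) (he : m * e = 0) :
    m * ((a + b - c) * deltaForm a b c e g h) = m * (a * b ^ 2) * (c + g) := by
  unfold deltaForm
  linear_combination (-a * b + a * c - 2 * b ^ 2 + 4 * b * c - 2 * c ^ 2) * ha + (-a + c + g) * hb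
    + (-4 * a * b + a * c - 2 * b ^ 2 + b * c) * hc + (-b ^ 2) * hcg + (-a * b - b ^ 2 + b * c) *
    hh + (-a - b + c) * he + (m * a * b ^ 2 * c) * h3

theorem pow_five_mul_deltaForm_eq_zero (h3 : (3 : R) = 0) {x y a b c : R}
    (hx : x ^ 9 = 0) (hy : y ^ 9 = 0) (ha : a ^ 5 = 0) (hb : b ^ 3 = 0)
    (hc : c = x ^ 2 * y ^ 2 * (x + y) ^ 2) :
    (a + b - c) ^ 5 *
      deltaForm a b c (x ^ 7 * y ^ 7 * (x + y) ^ 4) ((x - y) ^ 6) (x ^ 6 * y ^ 6) = 0 := by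
  have hc3 : c ^ 3 = 0 := by
    subst hc
    linear_combination (x ^ 3 * y ^ 6 + 6 * x ^ 2 * y ^ 7 + 15 * x * y ^ 8 + 20 * y ^ 9) * hx +
      (15 * x ^ 8 * y + 6 * x ^ 7 * y ^ 2 + x ^ 6 * y ^ 3) * hy
  have hcube : (a + b - c) ^ 3 = a ^ 3 := by
    rw [sub_cube_of_three_eq_zero h3, add_cube_of_three_eq_zero h3, hb, hc3]
    ring
  have hcg : c ^ 2 * (x - y) ^ 6 = 0 := by
    subst hc
    linear_combination (x ^ 5 * y ^ 4 - 2 * x ^ 4 * y ^ 5 - 3 * x ^ 3 * y ^ 6 + 8 * x ^ 2 * y ^ 7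
      + 2 * x * y ^ 8 - 12 * y ^ 9) * hx + (2 * x ^ 8 * y + 8 * x ^ 7 * y ^ 2 - 3 * x ^ 6 * y ^ 3
      - 2 * x ^ 5 * y ^ 4 + x ^ 4 * y ^ 5) * hy
  have hch : c * (x ^ 6 * y ^ 6) = 0 := by
    subst hc
    linear_combination (x * y ^ 8 + 2 * y ^ 9) * hx + (x ^ 8 * y) * hy
  have he : x ^ 7 * y ^ 7 * (x + y) ^ 4 = 0 := by
    linear_combination (x ^ 2 * y ^ 7 + 4 * x * y ^ 8 + 6 * y ^ 9) * hx + (4 * x ^ 8 * y + x ^ 7 *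
      y ^ 2) * hy
  have hlast : c * (x - y) ^ 6 + x ^ 6 * y ^ 6 - c ^ 2 = 0 := by
    subst hc
    linear_combination (x * y ^ 2 - 4 * y ^ 3) * hx + (-4 * x ^ 3 + x ^ 2 * y) * hy + (x ^ 8 * y ^
      4 - 5 * x ^ 6 * y ^ 6 + x ^ 4 * y ^ 8) * h3
  have key := mul_sq_mul_deltaForm h3 (m := a ^ 3) (a := a) (b := b) (c := c)
    (by linear_combination ha) (by rw [hb, mul_zero]) (by rw [hc3, mul_zero])
    (by rw [hcg, mul_zero]) (by rw [hch, mul_zero])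
    (show a ^ 3 * (x ^ 7 * y ^ 7 * (x + y) ^ 4) = 0 by rw [he, mul_zero])
  rw [hlast, mul_zero, ← hcube] at key
  rw [← key]
  ring

theorem pow_fourteen_mul_deltaForm_pow_four (h3 : (3 : R) = 0) {x y a b c : R}
    (hx : x ^ 27 = 0) (hy : y ^ 27 = 0) (ha : a ^ 14 = 0) (hb : b ^ 9 = 0)
    (hc : c = x ^ 2 * y ^ 2 * (x + y) ^ 2) :
    x ^ 18 * y ^ 4 * ((a + b - c) ^ 14 *
      deltaForm a b c (x ^ 7 * y ^ 7 * (x + y) ^ 4) ((x - y) ^ 6) (x ^ 6 * y ^ 6) ^ 4) =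
      x ^ 26 * y ^ 26 * a ^ 13 * b ^ 8 := by
  have hc3 : c ^ 3 = x ^ 6 * y ^ 6 * (x ^ 3 + y ^ 3) ^ 2 := by
    rw [← add_cube_of_three_eq_zero h3, hc]
    ring
  have hg3 : ((x - y) ^ 6) ^ 3 = (x ^ 9 - y ^ 9) ^ 2 := by
    rw [show x ^ 9 - y ^ 9 = (x - y) ^ 9 by
      rw [show (x - y) ^ 9 = ((x - y) ^ 3) ^ 3 by ring]
      simp only [sub_cube_of_three_eq_zero h3]
      ring]
    ring
  have hc9 : (c ^ 3) ^ 3 = 0 := by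
    rw [hc3]
    linear_combination (x ^ 9 * y ^ 18 + 6 * x ^ 6 * y ^ 21 + 15 * x ^ 3 * y ^ 24 + 20 * y ^ 27) *
      hx + (15 * x ^ 24 * y ^ 3 + 6 * x ^ 21 * y ^ 6 + x ^ 18 * y ^ 9) * hy
  have hpow_nine : (a + b - c) ^ 9 = a ^ 9 := by
    rw [show (a + b - c) ^ 9 = ((a + b - c) ^ 3) ^ 3 by ring]
    simp only [sub_cube_of_three_eq_zero h3, add_cube_of_three_eq_zero h3]
    linear_combination hb - hc9
  have hcubes := mul_mul_deltaForm h3 (m := a ^ 9 * (x ^ 18 * y ^ 4)) (a := a ^ 3) (b := b ^ 3)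
    (c := c ^ 3) (e := (x ^ 7 * y ^ 7 * (x + y) ^ 4) ^ 3) (g := ((x - y) ^ 6) ^ 3)
    (h := (x ^ 6 * y ^ 6) ^ 3)
    (by linear_combination a * x ^ 18 * y ^ 4 * ha)
    (by linear_combination a ^ 9 * x ^ 18 * y ^ 4 * hb)
    (by
      rw [hc3]
      linear_combination a ^ 9 * ((x ^ 15 * y ^ 16 + 4 * x ^ 12 * y ^ 19 + 6 * x ^ 9 * y ^ 22 + 4
        * x ^ 6 * y ^ 25 + x ^ 3 * y ^ 28)) * hx)
    (by
      rw [hc3, hg3]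
      linear_combination a ^ 9 * (x ^ 21 * y ^ 10 + 2 * x ^ 18 * y ^ 13 + x ^ 15 * y ^ 16 - 2 * x
        ^ 12 * y ^ 19 - 4 * x ^ 9 * y ^ 22 - 2 * x ^ 6 * y ^ 25 + x ^ 3 * y ^ 28 + 2 * y ^ 31) *
        hx + a ^ 9 * (x ^ 24 * y ^ 7) * hy)
    (by linear_combination a ^ 9 * x ^ 9 * y ^ 22 * hx)
    (by linear_combination a ^ 9 * x ^ 12 * y ^ 25 * (x + y) ^ 12 * hx)
  have hsum : x ^ 18 * y ^ 4 * (c ^ 3 + ((x - y) ^ 6) ^ 3) =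
      x ^ 24 * y ^ 16 + x ^ 18 * y ^ 22 := by
    rw [hc3, hg3]
    linear_combination (x ^ 9 * y ^ 4 + x ^ 3 * y ^ 10) * hx
  have hk_c : (x ^ 24 * y ^ 16 + x ^ 18 * y ^ 22) * c ^ 3 = 0 := by
    subst hc
    linear_combination (x ^ 9 * y ^ 22 + 6 * x ^ 8 * y ^ 23 + 15 * x ^ 7 * y ^ 24 + 20 * x ^ 6 * y
      ^ 25 + 15 * x ^ 5 * y ^ 26 + 6 * x ^ 4 * y ^ 27 + 2 * x ^ 3 * y ^ 28 + 6 * x ^ 2 * y ^ 29 +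
      15 * x * y ^ 30 + 20 * y ^ 31) * hx + (15 * x ^ 26 * y ^ 5 + 6 * x ^ 25 * y ^ 6 + x ^ 24 * y
      ^ 7) * hy
  have hk_cg : (x ^ 24 * y ^ 16 + x ^ 18 * y ^ 22) * (c ^ 2 * (x - y) ^ 6) = 0 := by
    subst hc
    linear_combination (x ^ 11 * y ^ 20 - 2 * x ^ 10 * y ^ 21 - 3 * x ^ 9 * y ^ 22 + 8 * x ^ 8 * y
      ^ 23 + 2 * x ^ 7 * y ^ 24 - 12 * x ^ 6 * y ^ 25 + 3 * x ^ 5 * y ^ 26 + 6 * x ^ 4 * y ^ 27 -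
      6 * x ^ 3 * y ^ 28 + 6 * x ^ 2 * y ^ 29 + 3 * x * y ^ 30 - 12 * y ^ 31) * hx + (2 * x ^ 26 *
      y ^ 5 + 8 * x ^ 25 * y ^ 6 - 3 * x ^ 24 * y ^ 7 - 2 * x ^ 23 * y ^ 8 + x ^ 22 * y ^ 9) * hy
  have hk_ch : (x ^ 24 * y ^ 16 + x ^ 18 * y ^ 22) * (c * (x ^ 6 * y ^ 6)) = 0 := by
    subst hc
    linear_combination (x ^ 7 * y ^ 24 + 2 * x ^ 6 * y ^ 25 + x ^ 5 * y ^ 26 + x * y ^ 30 + 2 * y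
      ^ 31) * hx + (x ^ 26 * y ^ 5) * hy
  have hk_e : (x ^ 24 * y ^ 16 + x ^ 18 * y ^ 22) * (x ^ 7 * y ^ 7 * (x + y) ^ 4) = 0 := by
    linear_combination (x ^ 8 * y ^ 23 + 4 * x ^ 7 * y ^ 24 + 6 * x ^ 6 * y ^ 25 + 4 * x ^ 5 * y ^
      26 + x ^ 4 * y ^ 27 + x ^ 2 * y ^ 29 + 4 * x * y ^ 30 + 6 * y ^ 31) * hx + (4 * x ^ 26 * y ^
      5 + x ^ 25 * y ^ 6) * hy
  have hk_last : (x ^ 24 * y ^ 16 + x ^ 18 * y ^ 22) *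
      (c * (x - y) ^ 6 + x ^ 6 * y ^ 6 - c ^ 2) = x ^ 26 * y ^ 26 := by
    subst hc
    linear_combination (x ^ 7 * y ^ 18 - 4 * x ^ 6 * y ^ 19 + 3 * x ^ 5 * y ^ 20 - 15 * x ^ 3 * y
      ^ 22 + 4 * x * y ^ 24 - 8 * y ^ 25) * hx + (-15 * x ^ 24 * y + 3 * x ^ 22 * y ^ 3 - 4 * x ^
      21 * y ^ 4 + x ^ 20 * y ^ 5) * hy + (x ^ 26 * y ^ 26) * h3
  have key := mul_sq_mul_deltaForm h3 (m := a ^ 12 * b ^ 6 * (x ^ 24 * y ^ 16 + x ^ 18 * y ^ 22))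
    (a := a) (b := b) (c := c) (e := x ^ 7 * y ^ 7 * (x + y) ^ 4) (g := (x - y) ^ 6)
    (h := x ^ 6 * y ^ 6)
    (by linear_combination b ^ 6 * (x ^ 24 * y ^ 16 + x ^ 18 * y ^ 22) * ha)
    (by linear_combination a ^ 12 * (x ^ 24 * y ^ 16 + x ^ 18 * y ^ 22) * hb)
    (by rw [mul_assoc, hk_c, mul_zero]) (by rw [mul_assoc, hk_cg, mul_zero])
    (by rw [mul_assoc, hk_ch, mul_zero]) (by rw [mul_assoc, hk_e, mul_zero])
  rw [← deltaForm_cube h3, ← add_cube_of_three_eq_zero h3, ← sub_cube_of_three_eq_zero h3,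
    ← hpow_nine] at hcubes
  generalize deltaForm a b c _ _ _ = d at hcubes key ⊢
  calc x ^ 18 * y ^ 4 * ((a + b - c) ^ 14 * d ^ 4)
      = (a + b - c) ^ 9 * (x ^ 18 * y ^ 4) * ((a + b - c) ^ 3 * d ^ 3) *
          ((a + b - c) ^ 2 * d) := by ring
    _ = a ^ 12 * b ^ 6 * (x ^ 24 * y ^ 16 + x ^ 18 * y ^ 22) * ((a + b - c) ^ 2 * d) := by
        rw [hcubes, hpow_nine, ← hsum]
        ring
    _ = x ^ 26 * y ^ 26 * a ^ 13 * b ^ 8 := by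
        rw [key]
        linear_combination a ^ 13 * b ^ 8 * hk_last

end CharThree

theorem monomial_notMem_span_X_pow (k : Type*) [Field k] (s : Fin 4 →₀ ℕ) (n : ℕ)
    (hs : ∀ i, s i < n) :
    monomial s (1 : k) ∉
      Ideal.span ({X 0 ^ n, X 1 ^ n, X 2 ^ n, X 3 ^ n} : Set (MvPolynomial (Fin 4) k)) := by
  have hset : ({X 0 ^ n, X 1 ^ n, X 2 ^ n, X 3 ^ n} : Set (MvPolynomial (Fin 4) k)) =
      (fun t => monomial t (1 : k)) '' (Set.range fun i => Finsupp.single i n) := by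
    ext p
    simp [X_pow_eq_monomial, Fin.exists_fin_succ, eq_comm]
  rw [hset, mem_ideal_span_monomial_image]
  intro hmem
  obtain ⟨_, ⟨i, rfl⟩, hi⟩ := hmem s (by simp)
  exact (hs i).not_ge (by simpa using hi i)

/-- The explicit solution `D` of `3 * D = φ((f + 3G)²) - (f + 3G)⁶`, reduced modulo `3`. -/
theorem map_eq_of_three_mul_eq {k : Type*} [Field k] [CharP k 3]
    (φ : MvPolynomial (Fin 4) (WittVector 3 k) →+* MvPolynomial (Fin 4) (WittVector 3 k))
    (hφX : ∀ i : Fin 4, φ (X i) = X i ^ 3)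
    (r : WittVector 3 k →+* k)
    (f : MvPolynomial (Fin 4) (WittVector 3 k))
    (hf : f = X 3 ^ 2 + X 2 ^ 3 - X 0 ^ 2 * X 1 ^ 2 * (X 0 + X 1) ^ 2)
    (G : MvPolynomial (Fin 4) (WittVector 3 k))
    (hG : G = X 0 * X 1 * X 2 ^ 2 + X 0 ^ 2 * X 2 ^ 2 + X 1 ^ 2 * X 2 ^ 2
            - X 0 ^ 2 * X 1 ^ 2 * X 2)
    (D : MvPolynomial (Fin 4) (WittVector 3 k))
    (hD : 3 * D = φ ((f + 3 * G) ^ 2) - (f + 3 * G) ^ 6) :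
    MvPolynomial.map r D = -(MvPolynomial.map r f ^ 3 *
      deltaForm (X 3 ^ 2) (X 2 ^ 3) (X 0 ^ 2 * X 1 ^ 2 * (X 0 + X 1) ^ 2)
        (X 0 ^ 7 * X 1 ^ 7 * (X 0 + X 1) ^ 4) ((X 0 - X 1) ^ 6) (X 0 ^ 6 * X 1 ^ 6)) := by
  have h3 : (3 : MvPolynomial (Fin 4) k) = 0 := by
    exact_mod_cast CharP.cast_eq_zero (MvPolynomial (Fin 4) k) 3
  have h3W : (3 : MvPolynomial (Fin 4) (WittVector 3 k)) ≠ 0 := by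
    rw [← map_ofNat (C : WittVector 3 k →+* _) 3, Ne, C_eq_zero]
    exact_mod_cast WittVector.p_nonzero 3 k
  set T : MvPolynomial (Fin 4) (WittVector 3 k) :=
    -((X 3 ^ 2 + X 2 ^ 3) * (X 3 ^ 2 - X 0 ^ 2 * X 1 ^ 2 * (X 0 + X 1) ^ 2) *
        (X 2 ^ 3 - X 0 ^ 2 * X 1 ^ 2 * (X 0 + X 1) ^ 2)) +
      X 0 ^ 4 * X 1 ^ 4 * (X 0 + X 1) *
        (2 * (X 0 * X 1 * (X 0 + X 1)) ^ 3 - 3 * X 0 ^ 4 * X 1 ^ 4 * (X 0 + X 1)) +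
      (X 0 ^ 3 * X 1 ^ 3 * X 2 ^ 6 + X 0 ^ 6 * X 2 ^ 6 + X 1 ^ 6 * X 2 ^ 6
        - X 0 ^ 6 * X 1 ^ 6 * X 2 ^ 3) -
      3 * (f ^ 2 * G + 3 * f * G ^ 2 + 3 * G ^ 3) with hT
  have hφ : φ (f + 3 * G) = (f + 3 * G) ^ 3 + 3 * T := by
    rw [hT, hf, hG]
    simp only [map_add, map_sub, map_mul, map_pow, hφX, map_ofNat]
    ring
  have hDT : D = T * (2 * (f + 3 * G) ^ 3 + 3 * T) := by
    apply mul_left_cancel₀ h3W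
    rw [hD, map_pow, hφ]
    ring
  have hrT : MvPolynomial.map r T =
      deltaForm (X 3 ^ 2) (X 2 ^ 3) (X 0 ^ 2 * X 1 ^ 2 * (X 0 + X 1) ^ 2)
        (X 0 ^ 7 * X 1 ^ 7 * (X 0 + X 1) ^ 4) ((X 0 - X 1) ^ 6) (X 0 ^ 6 * X 1 ^ 6) := by
    simp only [hT, deltaForm, map_add, map_sub, map_mul, map_neg, map_pow, map_X, map_ofNat, h3,
      zero_mul, sub_zero]
    have hsq : (X 0 - X 1 : MvPolynomial (Fin 4) k) ^ 6 = (X 0 ^ 3 - X 1 ^ 3) ^ 2 := by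
      rw [← sub_cube_of_three_eq_zero h3]
      ring
    rw [hsq]
    linear_combination (X 0 ^ 7 * X 1 ^ 7 * (X 0 + X 1) ^ 4 + X 0 ^ 3 * X 1 ^ 3 * X 2 ^ 6) * h3
  rw [hDT, map_mul, hrT]
  simp only [map_add, map_mul, map_pow, map_ofNat, h3, zero_mul, add_zero]
  rw [show (2 : MvPolynomial (Fin 4) k) = -1 by linear_combination h3]
  ring



/-- 4A₂ del Pezzo: `W(k)[x,y,z,w]/(f + 3(xyz² + x²z² + y²z² − x²y²z))`
has quasi-F-splitting height 3. With notation as in the 4A₂ setting and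
`G = xyz² + x²z² + y²z² − x²y²z`: for every `D ∈ S` with `3D = φ((f+3G)²) − (f+3G)⁶`,
`ρ(f²·D) ∈ (x⁹, y⁹, z⁹, w⁹)` and `ρ(f²·D⁴) ∉ (x²⁷, y²⁷, z²⁷, w²⁷)`. -/
theorem stmt16 (k : Type*) [Field k] [IsAlgClosed k] [CharP k 3]
    (φ : MvPolynomial (Fin 4) (WittVector 3 k) →+* MvPolynomial (Fin 4) (WittVector 3 k))
    (hφC : ∀ α : WittVector 3 k, φ (C α) = C (WittVector.frobenius α))
    (hφX : ∀ i : Fin 4, φ (X i) = X i ^ 3)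
    (r : WittVector 3 k →+* k)
    (hr : ∀ α : WittVector 3 k, r α = α.coeff 0)
    (f : MvPolynomial (Fin 4) (WittVector 3 k))
    (hf : f = X 3 ^ 2 + X 2 ^ 3 - X 0 ^ 2 * X 1 ^ 2 * (X 0 + X 1) ^ 2)
    (G : MvPolynomial (Fin 4) (WittVector 3 k))
    (hG : G = X 0 * X 1 * X 2 ^ 2 + X 0 ^ 2 * X 2 ^ 2 + X 1 ^ 2 * X 2 ^ 2
            - X 0 ^ 2 * X 1 ^ 2 * X 2)
    (D : MvPolynomial (Fin 4) (WittVector 3 k))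
    (hD : 3 * D = φ ((f + 3 * G) ^ 2) - (f + 3 * G) ^ 6) :
    MvPolynomial.map r (f ^ 2 * D)
        ∈ Ideal.span ({X 0 ^ 9, X 1 ^ 9, X 2 ^ 9, X 3 ^ 9} : Set (MvPolynomial (Fin 4) k)) ∧
    MvPolynomial.map r (f ^ 2 * D ^ 4)
        ∉ Ideal.span ({X 0 ^ 27, X 1 ^ 27, X 2 ^ 27, X 3 ^ 27} : Set (MvPolynomial (Fin 4) k)) := by
  have h3 : (3 : MvPolynomial (Fin 4) k) = 0 := by
    exact_mod_cast CharP.cast_eq_zero (MvPolynomial (Fin 4) k) 3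
  have hrD := map_eq_of_three_mul_eq φ hφX r f hf G hG D hD
  have hrf : MvPolynomial.map r f = X 3 ^ 2 + X 2 ^ 3 - X 0 ^ 2 * X 1 ^ 2 * (X 0 + X 1) ^ 2 := by
    simp [hf]
  rw [hrf] at hrD
  constructor
  · set I := Ideal.span ({X 0 ^ 9, X 1 ^ 9, X 2 ^ 9, X 3 ^ 9} : Set (MvPolynomial (Fin 4) k))
    let q := Ideal.Quotient.mk I
    have h0 (i : Fin 4) : q (X i) ^ 9 = 0 := by
      rw [← map_pow]
      refine Ideal.Quotient.eq_zero_iff_mem.mpr (Ideal.subset_span ?_)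
      fin_cases i <;> simp
    have key := pow_five_mul_deltaForm_eq_zero
      (by rw [← map_ofNat q 3, h3, map_zero]) (h0 0) (h0 1)
      (a := q (X 3) ^ 2) (by linear_combination q (X 3) * h0 3) (b := q (X 2) ^ 3)
      (by linear_combination h0 2) rfl
    rw [← Ideal.Quotient.eq_zero_iff_mem, map_mul, map_pow, hrf, hrD]
    change q _ = 0
    simp only [map_deltaForm, map_add, map_sub, map_mul, map_neg, map_pow] at key ⊢
    linear_combination -key
  · set I := Ideal.span ({X 0 ^ 27, X 1 ^ 27, X 2 ^ 27, X 3 ^ 27} : Set (MvPolynomial (Fin 4) k))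
    let q := Ideal.Quotient.mk I
    have h0 (i : Fin 4) : q (X i) ^ 27 = 0 := by
      rw [← map_pow]
      refine Ideal.Quotient.eq_zero_iff_mem.mpr (Ideal.subset_span ?_)
      fin_cases i <;> simp
    have key := pow_fourteen_mul_deltaForm_pow_four
      (by rw [← map_ofNat q 3, h3, map_zero]) (h0 0) (h0 1)
      (a := q (X 3) ^ 2) (by linear_combination q (X 3) * h0 3) (b := q (X 2) ^ 3)
      (by linear_combination h0 2) rfl
    intro hmem
    rw [← Ideal.Quotient.eq_zero_iff_mem, map_mul, map_pow, map_pow, hrf, hrD] at hmem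
    change q _ = 0 at hmem
    have hzero : q (X 0 ^ 26 * X 1 ^ 26 * X 2 ^ 24 * X 3 ^ 26) = 0 := by
      simp only [map_deltaForm, map_add, map_sub, map_mul, map_neg, map_pow] at key hmem ⊢
      generalize deltaForm (q (X 3) ^ 2) (q (X 2) ^ 3)
        (q (X 0) ^ 2 * q (X 1) ^ 2 * (q (X 0) + q (X 1)) ^ 2)
        (q (X 0) ^ 7 * q (X 1) ^ 7 * (q (X 0) + q (X 1)) ^ 4)
        ((q (X 0) - q (X 1)) ^ 6) (q (X 0) ^ 6 * q (X 1) ^ 6) = d at key hmem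
      generalize q (X 3) ^ 2 + q (X 2) ^ 3 -
        q (X 0) ^ 2 * q (X 1) ^ 2 * (q (X 0) + q (X 1)) ^ 2 = F at key hmem
      linear_combination q (X 0) ^ 18 * q (X 1) ^ 4 * hmem - key
    rw [Ideal.Quotient.eq_zero_iff_mem] at hzero
    refine monomial_notMem_span_X_pow k (Finsupp.equivFunOnFinite.symm ![26, 26, 24, 26]) 27
      (fun i => by fin_cases i <;> simp) ?_
    convert hzero using 1
    rw [monomial_eq, Finsupp.prod_fintype _ _ (by simp)]
    simp [Fin.prod_univ_four]
end

section
/- For every homogeneous element G ∈ S of degree 6 and every D ∈ S with 3D = φ((f+3G)²) − (f+3G)⁶, it is not the case that both ρ(f²·D) ∈ m^[9] = (x⁹, y⁹, z⁹, w⁹) and ρ(f²·D⁴) ∈ m^[27] = (x²⁷, y²⁷, z²⁷, w²⁷). (This is the computational content of the statement that W(k)[x,y,z,w]/(f+3G) is 3-quasi-F-split for every homogeneous G of degree 6.) -/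
open MvPolynomial

noncomputable section

namespace FourA2

/-- The exponent vector of `x ^ a * y ^ b * z ^ c * w ^ d`. -/
def expo (a b c d : ℕ) : Fin 4 →₀ ℕ := Finsupp.equivFunOnFinite.symm ![a, b, c, d]

section Coefficients

variable {R : Type*} [CommRing R]

lemma expo_zero : expo 0 0 0 0 = 0 := by
  ext i
  fin_cases i <;> rfl

lemma expo_le {a b c d a' b' c' d' : ℕ} :
    expo a b c d ≤ expo a' b' c' d' ↔ a ≤ a' ∧ b ≤ b' ∧ c ≤ c' ∧ d ≤ d' := by
  simp [Finsupp.le_def, Fin.forall_fin_succ, expo]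

lemma expo_sub (a b c d a' b' c' d' : ℕ) :
    expo a b c d - expo a' b' c' d' = expo (a - a') (b - b') (c - c') (d - d') := by
  ext i
  fin_cases i <;> simp [expo]

lemma monomial_expo (a b c d : ℕ) :
    monomial (expo a b c d) (1 : R) = X 0 ^ a * X 1 ^ b * X 2 ^ c * X 3 ^ d := by
  rw [monomial_eq, Finsupp.prod_fintype _ _ (by simp)]
  simp [Fin.prod_univ_four, expo]

lemma coeff_expo_mul (a b c d a' b' c' d' : ℕ) (p : MvPolynomial (Fin 4) R) :
    coeff (expo a b c d) (X 0 ^ a' * X 1 ^ b' * X 2 ^ c' * X 3 ^ d' * p) =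
      if a' ≤ a ∧ b' ≤ b ∧ c' ≤ c ∧ d' ≤ d then
        coeff (expo (a - a') (b - b') (c - c') (d - d')) p else 0 := by
  simp only [← monomial_expo, coeff_monomial_mul', expo_le, expo_sub, one_mul]

lemma coeff_X_pow_mul_of_lt {m : Fin 4 →₀ ℕ} {i : Fin 4} {n : ℕ} (h : m i < n)
    (p : MvPolynomial (Fin 4) R) : coeff m (X i ^ n * p) = 0 := by
  rw [X_pow_eq_monomial, coeff_monomial_mul', if_neg]
  rw [Finsupp.single_le_iff]
  omega

/-- A polynomial in the ideal generated by powers of the variables has no monomial outside it. -/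
lemma coeff_eq_zero_of_mem_span {m : Fin 4 →₀ ℕ} {a b c d : ℕ} (ha : m 0 < a) (hb : m 1 < b)
    (hc : m 2 < c) (hd : m 3 < d) {p : MvPolynomial (Fin 4) R}
    (hp : p ∈ Ideal.span ({X 0 ^ a, X 1 ^ b, X 2 ^ c, X 3 ^ d} :
      Set (MvPolynomial (Fin 4) R))) : coeff m p = 0 := by
  simp only [Ideal.mem_span_insert, Ideal.mem_span_singleton'] at hp
  obtain ⟨P, _, ⟨Q, _, ⟨U, _, ⟨V, rfl⟩, rfl⟩, rfl⟩, rfl⟩ := hp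
  simp only [mul_comm _ (X _ ^ _), coeff_add, coeff_X_pow_mul_of_lt ha, coeff_X_pow_mul_of_lt hb,
    coeff_X_pow_mul_of_lt hc, coeff_X_pow_mul_of_lt hd, add_zero]

end Coefficients

section Frobenius

variable {k : Type*} [Field k] [CharP k 3]

lemma pow_three_eq_expand (p : MvPolynomial (Fin 4) k) :
    p ^ 3 = expand 3 (map (frobenius k 3) p) := by
  have : Fact (Nat.Prime 3) := ⟨Nat.prime_three⟩
  rw [← map_expand, map_frobenius_expand]

/-- The coefficients of `p ^ 3 * x ^ i * y ^ j * z ^ l * w ^ n` in characteristic three. -/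
lemma coeff_pow_three_mul (p : MvPolynomial (Fin 4) k) (a b c d : ℕ) {r s t u r' s' t' u' : ℕ}
    (hr : r < 3) (hs : s < 3) (ht : t < 3) (hu : u < 3)
    (hr' : r' < 3) (hs' : s' < 3) (ht' : t' < 3) (hu' : u' < 3) :
    coeff (expo (3 * a + r) (3 * b + s) (3 * c + t) (3 * d + u))
        (X 0 ^ r' * X 1 ^ s' * X 2 ^ t' * X 3 ^ u' * p ^ 3) =
      if r = r' ∧ s = s' ∧ t = t' ∧ u = u' then coeff (expo a b c d) p ^ 3 else 0 := by
  rw [coeff_expo_mul, pow_three_eq_expand]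
  split_ifs with h1 h2 h2
  · obtain ⟨rfl, rfl, rfl, rfl⟩ := h2
    have : expo (3 * a + r - r) (3 * b + s - s) (3 * c + t - t) (3 * d + u - u) =
        3 • expo a b c d := by
      ext i
      fin_cases i <;> simp [expo]
    rw [this, coeff_expand_smul _ (by norm_num), coeff_map, frobenius_def]
  · by_contra hne
    have key : ∀ i, 3 ∣ expo (3 * a + r - r') (3 * b + s - s') (3 * c + t - t')
        (3 * d + u - u') i := fun i ↦ by
      by_contra hi
      exact hne (coeff_expand_of_not_dvd _ hi)
    have k0 := key 0
    have k1 := key 1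
    have k2 := key 2
    have k3 := key 3
    simp [expo] at k0 k1 k2 k3
    omega
  · omega
  · rfl

end Frobenius

section CharThree

variable {k : Type*} [Field k]

local notation "𝐱" => (X 0 : MvPolynomial (Fin 4) k)
local notation "𝐲" => (X 1 : MvPolynomial (Fin 4) k)
local notation "𝐳" => (X 2 : MvPolynomial (Fin 4) k)
local notation "𝐰" => (X 3 : MvPolynomial (Fin 4) k)

/-- The equation of the 4A₂ del Pezzo surface. -/
def eqn (R : Type*) [CommRing R] : MvPolynomial (Fin 4) R :=
  X 3 ^ 2 + X 2 ^ 3 - X 0 ^ 2 * X 1 ^ 2 * (X 0 + X 1) ^ 2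

/-- The polynomial `δ` with `φ f = f ^ 3 + 3 δ`, for `f` the equation of the surface and `φ` the
Frobenius lift raising the variables to their cubes. -/
def delta (R : Type*) [CommRing R] : MvPolynomial (Fin 4) R :=
  X 0 ^ 7 * X 1 ^ 7 * (X 0 + X 1) *
      (2 * X 0 ^ 3 + 3 * X 0 ^ 2 * X 1 + 3 * X 0 * X 1 ^ 2 + 2 * X 1 ^ 3) -
    (X 3 ^ 2 + X 2 ^ 3) * (X 3 ^ 2 - X 0 ^ 2 * X 1 ^ 2 * (X 0 + X 1) ^ 2) *
      (X 2 ^ 3 - X 0 ^ 2 * X 1 ^ 2 * (X 0 + X 1) ^ 2)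

/-- The cube root of the part of `f ^ 2 * (δ + g ^ 3)` with exponents congruent to `(2, 1, 0, 2)`
is `y * rootXXY g`. -/
def rootXXY (g : MvPolynomial (Fin 4) k) : MvPolynomial (Fin 4) k :=
  eqn k + g - 𝐳 ^ 3 - 𝐱 * (𝐱 + 𝐲) * 𝐳 ^ 2 + 𝐱 ^ 2 * 𝐲 * (𝐱 + 𝐲) * 𝐳

/-- The cube root of the part of `f ^ 2 * (δ + g ^ 3)` with exponents congruent to `(1, 2, 0, 2)`
is `x * rootXYY g`. -/
def rootXYY (g : MvPolynomial (Fin 4) k) : MvPolynomial (Fin 4) k :=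
  eqn k + g - 𝐳 ^ 3 - 𝐲 * (𝐱 + 𝐲) * 𝐳 ^ 2 + 𝐱 * 𝐲 ^ 2 * (𝐱 + 𝐲) * 𝐳

lemma coeff_rootXXY (g : MvPolynomial (Fin 4) k) :
    coeff (expo 2 0 2 0) (rootXXY g) = coeff (expo 2 0 2 0) g - 1 := by
  have h : rootXXY g = g - 𝐱 ^ 2 * 𝐲 ^ 0 * 𝐳 ^ 2 * 𝐰 ^ 0 * 1 + 𝐰 ^ 2 * 1 +
      𝐲 ^ 1 * (𝐱 ^ 2 * (𝐱 + 𝐲) * 𝐳 - 𝐱 * 𝐳 ^ 2 - 𝐱 ^ 2 * 𝐲 * (𝐱 + 𝐲) ^ 2) := by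
    simp only [rootXXY, eqn]
    ring
  rw [h]
  simp only [coeff_add, coeff_sub, coeff_expo_mul]
  rw [coeff_X_pow_mul_of_lt (by simp [expo]), coeff_X_pow_mul_of_lt (by simp [expo])]
  simp [expo_zero]

lemma coeff_eqn_mul_y_mul_rootXXY (g : MvPolynomial (Fin 4) k) :
    coeff (expo 2 1 2 2) (eqn k * (𝐲 * rootXXY g)) = coeff (expo 2 0 2 0) g - 1 := by
  rw [← coeff_rootXXY]
  have h : eqn k * (𝐲 * rootXXY g) = 𝐱 ^ 0 * 𝐲 ^ 1 * 𝐳 ^ 0 * 𝐰 ^ 2 * rootXXY g +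
      𝐳 ^ 3 * (𝐲 * rootXXY g) + 𝐲 ^ 2 * (-𝐱 ^ 2 * 𝐲 * (𝐱 + 𝐲) ^ 2 * rootXXY g) := by
    simp only [eqn]
    ring
  rw [h]
  simp only [coeff_add, coeff_expo_mul]
  rw [coeff_X_pow_mul_of_lt (by simp [expo]), coeff_X_pow_mul_of_lt (by simp [expo])]
  simp

lemma coeff_eqn_mul_x_mul_rootXYY (g : MvPolynomial (Fin 4) k) :
    coeff (expo 1 2 2 2) (eqn k * (𝐱 * rootXYY g)) = coeff (expo 0 2 2 0) g - 1 := by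
  have h : eqn k * (𝐱 * rootXYY g) = 𝐱 ^ 1 * 𝐲 ^ 0 * 𝐳 ^ 0 * 𝐰 ^ 2 * g -
      𝐱 ^ 1 * 𝐲 ^ 2 * 𝐳 ^ 2 * 𝐰 ^ 2 * 1 + 𝐰 ^ 3 * (𝐰 * 𝐱) + 𝐳 ^ 3 * (𝐱 * rootXYY g) +
      𝐱 ^ 2 * (𝐰 ^ 2 * (𝐲 ^ 2 * (𝐱 + 𝐲) * 𝐳 - 𝐲 * 𝐳 ^ 2 - 𝐱 * 𝐲 ^ 2 * (𝐱 + 𝐲) ^ 2) -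
        𝐱 * 𝐲 ^ 2 * (𝐱 + 𝐲) ^ 2 * rootXYY g) := by
    simp only [rootXYY, eqn]
    ring
  rw [h]
  simp only [coeff_add, coeff_sub, coeff_expo_mul]
  rw [coeff_X_pow_mul_of_lt (by simp [expo]), coeff_X_pow_mul_of_lt (by simp [expo]),
    coeff_X_pow_mul_of_lt (by simp [expo])]
  simp [expo_zero]

lemma coeff_eqn_mul_rootXXY (g : MvPolynomial (Fin 4) k) :
    coeff (expo 0 2 2 2) (eqn k * rootXXY g) = coeff (expo 0 2 2 0) g := by
  have h : eqn k * rootXXY g = 𝐱 ^ 0 * 𝐲 ^ 0 * 𝐳 ^ 0 * 𝐰 ^ 2 * g +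
      𝐰 ^ 3 * 𝐰 + 𝐳 ^ 3 * rootXXY g +
      𝐱 ^ 1 * (𝐰 ^ 2 * (𝐱 * 𝐲 * (𝐱 + 𝐲) * 𝐳 - (𝐱 + 𝐲) * 𝐳 ^ 2 - 𝐱 * 𝐲 ^ 2 * (𝐱 + 𝐲) ^ 2) -
        𝐱 * 𝐲 ^ 2 * (𝐱 + 𝐲) ^ 2 * rootXXY g) := by
    simp only [rootXXY, eqn]
    ring
  rw [h]
  simp only [coeff_add, coeff_expo_mul]
  rw [coeff_X_pow_mul_of_lt (by simp [expo]), coeff_X_pow_mul_of_lt (by simp [expo]),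
    coeff_X_pow_mul_of_lt (by simp [expo])]
  simp

lemma exists_eq_of_isWeightedHomogeneous {g : MvPolynomial (Fin 4) k}
    (hg : IsWeightedHomogeneous (![1, 1, 2, 3] : Fin 4 → ℕ) g 6) :
    ∃ p q r s : MvPolynomial (Fin 4) k, g = C (coeff (expo 2 0 2 0) g) * (𝐱 ^ 2 * 𝐳 ^ 2) +
      𝐱 ^ 3 * p + 𝐲 * q + 𝐳 ^ 3 * r + 𝐰 * s := by
  have hmem : g - monomial (expo 2 0 2 0) (coeff (expo 2 0 2 0) g) ∈ Ideal.span
      ((fun m ↦ monomial m (1 : k)) ''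
        {expo 3 0 0 0, expo 0 1 0 0, expo 0 0 3 0, expo 0 0 0 1}) := by
    rw [mem_ideal_span_monomial_image]
    intro m hm
    rw [mem_support_iff, coeff_sub, coeff_monomial] at hm
    have hne : expo 2 0 2 0 ≠ m := by
      rintro rfl
      simp at hm
    rw [if_neg hne, sub_zero] at hm
    have hw := hg hm
    rw [Finsupp.weight_apply, Finsupp.sum_fintype _ _ (by simp)] at hw
    simp [Fin.sum_univ_four] at hw
    by_contra! hcon
    simp [expo, Finsupp.le_def, Fin.forall_fin_succ] at hcon
    refine hne ?_
    ext i
    fin_cases i <;> simp [expo] <;> omega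
  simp only [Set.image_insert_eq, Set.image_singleton, Ideal.mem_span_insert,
    Ideal.mem_span_singleton', monomial_expo] at hmem
  obtain ⟨p, _, ⟨q, _, ⟨r, _, ⟨s, rfl⟩, rfl⟩, rfl⟩, h⟩ := hmem
  refine ⟨p, q, r, s, ?_⟩
  rw [sub_eq_iff_eq_add, ← mul_one (coeff (expo 2 0 2 0) g), ← C_mul_monomial,
    monomial_expo] at h
  linear_combination h

variable [CharP k 3]

lemma three_eq_zero : (3 : MvPolynomial (Fin 4) k) = 0 :=
  CharP.cast_eq_zero (MvPolynomial (Fin 4) k) 3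

/-- The decomposition of `f ^ 2 * (δ + g ^ 3)` in the basis of monomials over the cubes. -/
lemma exists_eqn_sq_mul_eq (g : MvPolynomial (Fin 4) k) :
    ∃ p₁ p₂ p₃ p₄ p₅ p₆ p₇ : MvPolynomial (Fin 4) k,
      eqn k ^ 2 * (delta k + g ^ 3) =
        𝐱 ^ 2 * 𝐲 ^ 1 * 𝐳 ^ 0 * 𝐰 ^ 2 * (𝐲 * rootXXY g) ^ 3 +
        𝐱 ^ 1 * 𝐲 ^ 2 * 𝐳 ^ 0 * 𝐰 ^ 2 * (𝐱 * rootXYY g) ^ 3 +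
        𝐱 ^ 0 * 𝐲 ^ 0 * 𝐳 ^ 0 * 𝐰 ^ 2 * p₁ ^ 3 +
        𝐱 ^ 2 * 𝐲 ^ 1 * 𝐳 ^ 0 * 𝐰 ^ 1 * p₂ ^ 3 +
        𝐱 ^ 1 * 𝐲 ^ 2 * 𝐳 ^ 0 * 𝐰 ^ 1 * p₃ ^ 3 +
        𝐱 ^ 0 * 𝐲 ^ 0 * 𝐳 ^ 0 * 𝐰 ^ 1 * p₄ ^ 3 +
        𝐱 ^ 2 * 𝐲 ^ 1 * 𝐳 ^ 0 * 𝐰 ^ 0 * p₅ ^ 3 +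
        𝐱 ^ 1 * 𝐲 ^ 2 * 𝐳 ^ 0 * 𝐰 ^ 0 * p₆ ^ 3 +
        𝐱 ^ 0 * 𝐲 ^ 0 * 𝐳 ^ 0 * 𝐰 ^ 0 * p₇ ^ 3 := by
  have : Fact (Nat.Prime 3) := ⟨Nat.prime_three⟩
  let e := 𝐳 ^ 2 - 𝐳 * 𝐱 * 𝐲
  let e₁ := 𝐱 * 𝐲 * (𝐱 + 𝐲) + 𝐳 * 𝐲
  let e₂ := 𝐱 * 𝐲 * (𝐱 + 𝐲) + 𝐳 * 𝐱
  let q := g - 𝐳 ^ 2 * 𝐱 * 𝐲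
  let q₁ := 𝐳 ^ 2 * 𝐲 - 𝐳 * 𝐱 * 𝐲 * (𝐱 + 𝐲) - 𝐱 ^ 2 * 𝐲 ^ 2 * (𝐱 + 𝐲)
  let q₂ := 𝐳 ^ 2 * 𝐱 - 𝐳 * 𝐱 * 𝐲 * (𝐱 + 𝐲) - 𝐱 ^ 2 * 𝐲 ^ 2 * (𝐱 + 𝐲)
  refine ⟨𝐱 * 𝐲 * (𝐱 * q₁ + 𝐲 * q₂) - (𝐳 + 𝐱 * 𝐲) * (eqn k + q), 𝐰 * q₁, 𝐰 * q₂, 𝐰 * q,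
    e * q₁ + e₁ * q + 𝐲 * e₂ * q₂, e * q₂ + e₂ * q + 𝐱 * e₁ * q₁,
    e * q + 𝐱 * 𝐲 * (e₁ * q₂ + e₂ * q₁), ?_⟩
  simp only [e, e₁, e₂, q, q₁, q₂, rootXXY, rootXYY, eqn, delta, add_pow_expChar (p := 3),
    sub_pow_expChar (p := 3), mul_pow, ← pow_mul]
  rw [← sub_eq_zero]
  have : CharP (MvPolynomial (Fin 4) k) 3 := inferInstance
  ring_nf
  reduce_mod_char!

lemma coeff_pow_three_mul_eqn_sq_XXY (g p : MvPolynomial (Fin 4) k) (a b c d : ℕ) :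
    coeff (expo (3 * a + 2) (3 * b + 1) (3 * c + 0) (3 * d + 2))
        (p ^ 3 * (eqn k ^ 2 * (delta k + g ^ 3))) =
      coeff (expo a b c d) (p * (𝐲 * rootXXY g)) ^ 3 := by
  obtain ⟨p₁, p₂, p₃, p₄, p₅, p₆, p₇, h⟩ := exists_eqn_sq_mul_eq g
  simp only [h, mul_add, mul_left_comm (p ^ 3), ← mul_pow p, coeff_add]
  repeat rw [coeff_pow_three_mul _ a b c d (by norm_num) (by norm_num) (by norm_num)
    (by norm_num) (by norm_num) (by norm_num) (by norm_num) (by norm_num)]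
  simp

lemma coeff_pow_three_mul_eqn_sq_XYY (g p : MvPolynomial (Fin 4) k) (a b c d : ℕ) :
    coeff (expo (3 * a + 1) (3 * b + 2) (3 * c + 0) (3 * d + 2))
        (p ^ 3 * (eqn k ^ 2 * (delta k + g ^ 3))) =
      coeff (expo a b c d) (p * (𝐱 * rootXYY g)) ^ 3 := by
  obtain ⟨p₁, p₂, p₃, p₄, p₅, p₆, p₇, h⟩ := exists_eqn_sq_mul_eq g
  simp only [h, mul_add, mul_left_comm (p ^ 3), ← mul_pow p, coeff_add]
  repeat rw [coeff_pow_three_mul _ a b c d (by norm_num) (by norm_num) (by norm_num)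
    (by norm_num) (by norm_num) (by norm_num) (by norm_num) (by norm_num)]
  simp

lemma eqn_pow_three :
    eqn k ^ 3 = 𝐰 ^ 6 + 𝐳 ^ 9 - 𝐲 ^ 6 * (𝐱 ^ 2 * (𝐱 + 𝐲) ^ 2) ^ 3 := by
  have : Fact (Nat.Prime 3) := ⟨Nat.prime_three⟩
  simp only [eqn, add_pow_expChar (p := 3), sub_pow_expChar (p := 3), mul_pow, ← pow_mul]
  ring

/-- The fourth power of the equation times `δ` modulo `(y ^ 3, z ^ 9, w ^ 9)`. -/
lemma exists_eqn_pow_four_mul_delta :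
    ∃ p q r : MvPolynomial (Fin 4) k, eqn k ^ 4 * delta k =
      𝐱 ^ 4 * 𝐲 ^ 2 * 𝐳 ^ 6 * 𝐰 ^ 8 + 𝐲 ^ 3 * p + 𝐳 ^ 9 * q + 𝐰 ^ 9 * r := by
  let a := 𝐱 ^ 2 * (𝐱 + 𝐲) ^ 2
  let t := 𝐳 ^ 3 - 𝐲 ^ 2 * a
  refine ⟨𝐰 ^ 8 * 𝐳 ^ 6 * 𝐱 ^ 2 * (2 * 𝐱 + 𝐲) - 𝐰 ^ 8 * 𝐳 ^ 3 * 𝐲 * a ^ 2 +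
      𝐰 ^ 8 * 𝐲 ^ 3 * a ^ 3 + 𝐰 ^ 6 * 𝐳 ^ 3 * 𝐲 * (𝐲 ^ 2 * a ^ 3 - 2 * 𝐳 ^ 3 * a ^ 2) +
      𝐰 ^ 6 * 𝐱 ^ 7 * 𝐲 ^ 4 * (𝐱 + 𝐲) *
        (2 * 𝐱 ^ 3 + 3 * 𝐱 ^ 2 * 𝐲 + 3 * 𝐱 * 𝐲 ^ 2 + 2 * 𝐲 ^ 3) * eqn k -
      𝐲 ^ 3 * a ^ 3 * (eqn k * delta k),
    eqn k * delta k - 𝐰 ^ 8 + 𝐰 ^ 6 * 𝐲 ^ 2 * a, -𝐰 ^ 3 * t - 2 * 𝐰 * t ^ 2, ?_⟩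
  have h : eqn k * delta k = 𝐱 ^ 7 * 𝐲 ^ 7 * (𝐱 + 𝐲) *
        (2 * 𝐱 ^ 3 + 3 * 𝐱 ^ 2 * 𝐲 + 3 * 𝐱 * 𝐲 ^ 2 + 2 * 𝐲 ^ 3) * eqn k -
      𝐰 ^ 2 * t * (𝐰 ^ 2 + t) ^ 2 + (𝐰 ^ 2 + t) * 𝐳 ^ 3 * 𝐲 ^ 2 * a * t := by
    simp only [eqn, delta, a, t]
    ring
  simp only [a, t] at h ⊢
  linear_combination (eqn k * delta k) * eqn_pow_three (k := k) + 𝐰 ^ 6 * h +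
    (𝐰 ^ 8 * (𝐳 ^ 6 * 𝐲 ^ 2 * a - 𝐳 ^ 3 * 𝐲 ^ 4 * a ^ 2)) * three_eq_zero (k := k)

lemma coeff_eqn_pow_four_mul {g : MvPolynomial (Fin 4) k}
    (hg : IsWeightedHomogeneous (![1, 1, 2, 3] : Fin 4 → ℕ) g 6) :
    coeff (expo 6 3 8 8) (eqn k ^ 4 * (delta k + g ^ 3) * (𝐲 * rootXXY g)) =
      coeff (expo 2 0 2 0) g - 1 + coeff (expo 2 0 2 0) g ^ 3 * coeff (expo 0 2 2 0) g := by
  have : Fact (Nat.Prime 3) := ⟨Nat.prime_three⟩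
  obtain ⟨p, q, r, s, h⟩ := exists_eq_of_isWeightedHomogeneous hg
  obtain ⟨p', q', r', h'⟩ := exists_eqn_pow_four_mul_delta (k := k)
  have h3 : g ^ 3 = C (coeff (expo 2 0 2 0) g ^ 3) * (𝐱 ^ 6 * 𝐳 ^ 6) + 𝐱 ^ 9 * p ^ 3 +
      𝐲 ^ 3 * q ^ 3 + 𝐳 ^ 9 * r ^ 3 + 𝐰 ^ 3 * s ^ 3 := by
    conv_lhs => rw [h]
    simp only [add_pow_expChar (p := 3), mul_pow, ← pow_mul, C_pow]
  have key : eqn k ^ 4 * (delta k + g ^ 3) * (𝐲 * rootXXY g) =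
      𝐱 ^ 4 * 𝐲 ^ 3 * 𝐳 ^ 6 * 𝐰 ^ 8 * rootXXY g +
      𝐱 ^ 6 * 𝐲 ^ 1 * 𝐳 ^ 6 * 𝐰 ^ 6 * (C (coeff (expo 2 0 2 0) g ^ 3) * (eqn k * rootXXY g)) +
      𝐱 ^ 9 * (𝐰 ^ 6 * p ^ 3 * 𝐲 * eqn k * rootXXY g) +
      𝐲 ^ 4 * (p' * rootXXY g + 𝐰 ^ 6 * q ^ 3 * eqn k * rootXXY g -
        𝐲 ^ 3 * (𝐱 ^ 2 * (𝐱 + 𝐲) ^ 2) ^ 3 * g ^ 3 * eqn k * rootXXY g) +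
      𝐳 ^ 9 * (𝐲 * rootXXY g * (q' + 𝐰 ^ 6 * r ^ 3 * eqn k + g ^ 3 * eqn k)) +
      𝐰 ^ 9 * (𝐲 * rootXXY g * (r' + s ^ 3 * eqn k)) := by
    linear_combination (𝐲 * rootXXY g) * h' +
      (𝐲 * rootXXY g * eqn k * g ^ 3) * eqn_pow_three (k := k) +
      𝐰 ^ 6 * 𝐲 * rootXXY g * eqn k * h3
  rw [key]
  simp only [coeff_add, coeff_expo_mul, coeff_C_mul]
  rw [coeff_X_pow_mul_of_lt (by simp [expo]), coeff_X_pow_mul_of_lt (by simp [expo]),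
    coeff_X_pow_mul_of_lt (by simp [expo]), coeff_X_pow_mul_of_lt (by simp [expo])]
  simp [coeff_rootXXY, coeff_eqn_mul_rootXXY]

/-- No perturbation of `δ` by the cube of a form of degree six satisfies both membership
conditions. -/
theorem not_mem_and_mem {g : MvPolynomial (Fin 4) k}
    (hg : IsWeightedHomogeneous (![1, 1, 2, 3] : Fin 4 → ℕ) g 6) :
    ¬ (eqn k ^ 5 * (delta k + g ^ 3) ∈
          Ideal.span ({𝐱 ^ 9, 𝐲 ^ 9, 𝐳 ^ 9, 𝐰 ^ 9} : Set (MvPolynomial (Fin 4) k)) ∧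
       eqn k ^ 14 * (delta k + g ^ 3) ^ 4 ∈
          Ideal.span ({𝐱 ^ 27, 𝐲 ^ 27, 𝐳 ^ 27, 𝐰 ^ 27} : Set (MvPolynomial (Fin 4) k))) := by
  rintro ⟨h₁, h₂⟩
  rw [show eqn k ^ 5 * (delta k + g ^ 3) = eqn k ^ 3 * (eqn k ^ 2 * (delta k + g ^ 3)) by ring]
    at h₁
  rw [show eqn k ^ 14 * (delta k + g ^ 3) ^ 4 = (eqn k ^ 4 * (delta k + g ^ 3)) ^ 3 *
    (eqn k ^ 2 * (delta k + g ^ 3)) by ring] at h₂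
  have hXX : coeff (expo 2 0 2 0) g = 1 := by
    have := coeff_pow_three_mul_eqn_sq_XXY g (eqn k) 2 1 2 2
    rw [coeff_eq_zero_of_mem_span _ _ _ _ h₁, coeff_eqn_mul_y_mul_rootXXY] at this
    · exact sub_eq_zero.mp (pow_eq_zero_iff three_ne_zero |>.mp this.symm)
    all_goals simp [expo]
  have hYY : coeff (expo 0 2 2 0) g = 1 := by
    have := coeff_pow_three_mul_eqn_sq_XYY g (eqn k) 1 2 2 2
    rw [coeff_eq_zero_of_mem_span _ _ _ _ h₁, coeff_eqn_mul_x_mul_rootXYY] at this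
    · exact sub_eq_zero.mp (pow_eq_zero_iff three_ne_zero |>.mp this.symm)
    all_goals simp [expo]
  have := coeff_pow_three_mul_eqn_sq_XXY g (eqn k ^ 4 * (delta k + g ^ 3)) 6 3 8 8
  rw [coeff_eq_zero_of_mem_span _ _ _ _ h₂, coeff_eqn_pow_four_mul hg, hXX, hYY] at this
  · simp at this
  all_goals simp [expo]

end CharThree

end FourA2

end

/-- 4A₂ del Pezzo: every lift `W(k)[x,y,z,w]/(f+3G)` is 3-quasi-F-split.
With notation as in the 4A₂ setting: for every homogeneous `G ∈ S` of degree 6 (weights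
`deg x = deg y = 1`, `deg z = 2`, `deg w = 3`) and every `D ∈ S` with
`3D = φ((f+3G)²) − (f+3G)⁶`, it is not the case that both
`ρ(f²·D) ∈ (x⁹, y⁹, z⁹, w⁹)` and `ρ(f²·D⁴) ∈ (x²⁷, y²⁷, z²⁷, w²⁷)`. -/
theorem stmt17 (k : Type*) [Field k] [IsAlgClosed k] [CharP k 3]
    (φ : MvPolynomial (Fin 4) (WittVector 3 k) →+* MvPolynomial (Fin 4) (WittVector 3 k))
    (hφC : ∀ α : WittVector 3 k, φ (C α) = C (WittVector.frobenius α))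
    (hφX : ∀ i : Fin 4, φ (X i) = X i ^ 3)
    (r : WittVector 3 k →+* k)
    (hr : ∀ α : WittVector 3 k, r α = α.coeff 0)
    (f : MvPolynomial (Fin 4) (WittVector 3 k))
    (hf : f = X 3 ^ 2 + X 2 ^ 3 - X 0 ^ 2 * X 1 ^ 2 * (X 0 + X 1) ^ 2)
    (G : MvPolynomial (Fin 4) (WittVector 3 k))
    (hG : MvPolynomial.IsWeightedHomogeneous (![1, 1, 2, 3] : Fin 4 → ℕ) G 6)
    (D : MvPolynomial (Fin 4) (WittVector 3 k))
    (hD : 3 * D = φ ((f + 3 * G) ^ 2) - (f + 3 * G) ^ 6) :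
    ¬ (MvPolynomial.map r (f ^ 2 * D)
          ∈ Ideal.span ({X 0 ^ 9, X 1 ^ 9, X 2 ^ 9, X 3 ^ 9} : Set (MvPolynomial (Fin 4) k)) ∧
       MvPolynomial.map r (f ^ 2 * D ^ 4)
          ∈ Ideal.span ({X 0 ^ 27, X 1 ^ 27, X 2 ^ 27, X 3 ^ 27} : Set (MvPolynomial (Fin 4) k))) := by
  have : Fact (Nat.Prime 3) := ⟨Nat.prime_three⟩
  have h3 : (3 : MvPolynomial (Fin 4) (WittVector 3 k)) ≠ 0 := by
    have hp : (C ((3 : ℕ) : WittVector 3 k) : MvPolynomial (Fin 4) (WittVector 3 k)) ≠ 0 :=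
      C_ne_zero.mpr (WittVector.p_nonzero 3 k)
    rw [map_natCast] at hp
    exact_mod_cast hp
  have hφf : φ f = f ^ 3 + 3 * FourA2.delta _ := by
    simp only [hf, FourA2.delta, map_add, map_sub, map_mul, map_pow, hφX]
    ring
  have hφG : map r (φ G) = map r G ^ 3 := by
    have hcomp : (map r).comp φ = (frobenius (MvPolynomial (Fin 4) k) 3).comp (map r) := by
      ext i : 2
      · simp [hφC, hr, WittVector.coeff_frobenius_charP, frobenius_def]
      · simp [hφX, frobenius_def]
    exact RingHom.congr_fun hcomp G
  have hDE : D = 2 * (f + 3 * G) ^ 3 *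
        (FourA2.delta _ + φ G - 3 * f ^ 2 * G - 9 * f * G ^ 2 - 9 * G ^ 3) +
      3 * (FourA2.delta _ + φ G - 3 * f ^ 2 * G - 9 * f * G ^ 2 - 9 * G ^ 3) ^ 2 := by
    refine mul_left_cancel₀ h3 ?_
    rw [hD, map_pow, map_add, map_mul, hφf, map_ofNat]
    ring
  have hrf : map r f = FourA2.eqn k := by simp [hf, FourA2.eqn]
  have hrD : map r D = -(FourA2.eqn k ^ 3 * (FourA2.delta k + map r G ^ 3)) := by
    have hδ : map r (FourA2.delta _) = FourA2.delta k := by simp [FourA2.delta]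
    rw [hDE]
    simp only [map_add, map_sub, map_mul, map_pow, hrf, hφG, hδ, map_ofNat]
    have h9 : (9 : MvPolynomial (Fin 4) k) = 0 := by
      linear_combination 3 * FourA2.three_eq_zero (k := k)
    rw [h9, FourA2.three_eq_zero]
    linear_combination (FourA2.eqn k ^ 3 * (FourA2.delta k + map r G ^ 3)) *
      FourA2.three_eq_zero (k := k)
  have hg : IsWeightedHomogeneous (![1, 1, 2, 3] : Fin 4 → ℕ) (map r G) 6 := fun d hd ↦
    hG fun h ↦ hd (by rw [coeff_map, h, map_zero])
  rintro ⟨h₁, h₂⟩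
  refine FourA2.not_mem_and_mem hg ⟨?_, ?_⟩
  · rw [map_mul, map_pow, hrf, hrD] at h₁
    rw [← neg_mem_iff]
    convert h₁ using 1
    ring
  · rw [map_mul, map_pow, map_pow, hrf, hrD] at h₂
    convert h₂ using 1
    ring
end
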